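/- arXiv:math/0302090 — 2 statements merged into one kernel-verified Lean document; each statement's English description precedes it below -/
import Mathlib

section
/- Let p, q, u, v ∈ ℝ_alg[x_1,…,x_n] be polynomials with real algebraic coefficients, let C ⊆ ℝ^n be a compact semi-arithmetic set on which q and v are nonvanishing, and set f = p/q and g = u/v. Assume f is non-negative and not identically zero on C, and let I(s) = ∫_C f(x)^s g(x) dμ(x) for Re(s) > 0, extended meromorphically to ℂ. Then for every integer s_0, all coefficients a_i in the Laurent series expansion I(s) = Σ_{i ≥ N} a_i (s − s_0)^i of I at s_0 are periods. -/
open MeasureTheory Complex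

noncomputable section

/-- A subset of `ℝ^m` is *semi-arithmetic* if it is a finite union of finite intersections
of sets of the form `{x | f x > 0}` or `{x | f x = 0}`, where the `f` are polynomials in
`m` variables with real algebraic coefficients. -/
def IsSemiArithmetic {m : ℕ} (C : Set (Fin m → ℝ)) : Prop :=
  ∃ (k : ℕ) (l : Fin k → ℕ) (p : (i : Fin k) → Fin (l i) → MvPolynomial (Fin m) ℝ)
    (b : (i : Fin k) → Fin (l i) → Bool),
    (∀ i j d, IsAlgebraic ℚ ((p i j).coeff d)) ∧
    C = ⋃ i, ⋂ j,
      (if b i j then {x | MvPolynomial.eval x (p i j) = 0}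
       else {x | 0 < MvPolynomial.eval x (p i j)})

/-- A real number is a (real) period if it is the value of an absolutely convergent Lebesgue
integral of a rational function with real algebraic coefficients over a semi-arithmetic set. -/
def IsRealPeriod (x : ℝ) : Prop :=
  ∃ (m : ℕ) (C : Set (Fin m → ℝ)) (p q : MvPolynomial (Fin m) ℝ),
    IsSemiArithmetic C ∧
    (∀ d, IsAlgebraic ℚ (p.coeff d)) ∧ (∀ d, IsAlgebraic ℚ (q.coeff d)) ∧
    IntegrableOn (fun y => MvPolynomial.eval y p / MvPolynomial.eval y q) C volume ∧
    x = ∫ y in C, MvPolynomial.eval y p / MvPolynomial.eval y q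

/-- A complex number is a period if its real and imaginary parts are periods. -/
def IsPeriod (z : ℂ) : Prop := IsRealPeriod z.re ∧ IsRealPeriod z.im



def SAHolds {m : ℕ} (x : Fin m → ℝ) (c : MvPolynomial (Fin m) ℝ × Bool) : Prop :=
  if c.2 then MvPolynomial.eval x c.1 = 0 else 0 < MvPolynomial.eval x c.1

def AlgC {m : ℕ} (p : MvPolynomial (Fin m) ℝ) : Prop := ∀ d, IsAlgebraic ℚ (p.coeff d)

theorem isSA_iff {m : ℕ} (C : Set (Fin m → ℝ)) : IsSemiArithmetic C ↔
    ∃ L : List (List (MvPolynomial (Fin m) ℝ × Bool)),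
      (∀ l ∈ L, ∀ c ∈ l, AlgC c.1) ∧ C = {x | ∃ l ∈ L, ∀ c ∈ l, SAHolds x c} := by
  constructor
  · rintro ⟨k, l, p, b, h, rfl⟩
    refine ⟨List.ofFn fun i => List.ofFn fun j => (p i j, b i j), ?_, ?_⟩
    · simp only [List.mem_ofFn]
      rintro _ ⟨i, rfl⟩ c hc
      obtain ⟨j, rfl⟩ := List.mem_ofFn.1 hc
      exact h i j
    · ext x
      simp only [Set.mem_iUnion, Set.mem_iInter, Set.mem_ofPred_eq, List.mem_ofFn]
      constructor
      · rintro ⟨i, hi⟩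
        refine ⟨_, ⟨i, rfl⟩, ?_⟩
        intro c hc
        obtain ⟨j, rfl⟩ := List.mem_ofFn.1 hc
        have := hi j
        unfold SAHolds
        by_cases hb : b i j <;> simpa [hb] using this
      · rintro ⟨_, ⟨i, rfl⟩, h2⟩
        refine ⟨i, fun j => ?_⟩
        have := h2 _ (List.mem_ofFn.2 ⟨j, rfl⟩)
        unfold SAHolds at this
        by_cases hb : b i j <;> simpa [hb] using this
  · rintro ⟨L, h, rfl⟩
    refine ⟨L.length, fun i => (L.get i).length, fun i j => ((L.get i).get j).1,
      fun i j => ((L.get i).get j).2, fun i j => h _ (List.get_mem _ _) _ (List.get_mem _ _), ?_⟩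
    ext x
    simp only [Set.mem_iUnion, Set.mem_iInter, Set.mem_ofPred_eq]
    constructor
    · rintro ⟨l, hl, h2⟩
      obtain ⟨i, rfl⟩ := List.mem_iff_get.1 hl
      refine ⟨i, fun j => ?_⟩
      have := h2 _ (List.get_mem _ j)
      unfold SAHolds at this
      split_ifs at this ⊢ <;> simpa using this
    · rintro ⟨i, hi⟩
      refine ⟨_, List.get_mem L i, fun c hc => ?_⟩
      obtain ⟨j, rfl⟩ := List.mem_iff_get.1 hc
      have := hi j
      unfold SAHolds
      split_ifs at this ⊢ <;> simpa using this

theorem SA_pos {m : ℕ} {p : MvPolynomial (Fin m) ℝ} (hp : AlgC p) :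
    IsSemiArithmetic {x | 0 < MvPolynomial.eval x p} :=
  (isSA_iff _).2 ⟨[[(p, false)]], by simpa using hp, by simp [SAHolds]⟩

theorem SA_union {m : ℕ} {A B : Set (Fin m → ℝ)} (hA : IsSemiArithmetic A)
    (hB : IsSemiArithmetic B) : IsSemiArithmetic (A ∪ B) := by
  obtain ⟨L, h, rfl⟩ := (isSA_iff _).1 hA
  obtain ⟨L', h', rfl⟩ := (isSA_iff _).1 hB
  refine (isSA_iff _).2 ⟨L ++ L', ?_, ?_⟩
  · intro l hl
    rcases List.mem_append.1 hl with h1 | h1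
    · exact h l h1
    · exact h' l h1
  · ext x
    simp only [Set.mem_union, Set.mem_ofPred_eq, List.mem_append]
    constructor
    · rintro (⟨l, a, b⟩ | ⟨l, a, b⟩)
      · exact ⟨l, Or.inl a, b⟩
      · exact ⟨l, Or.inr a, b⟩
    · rintro ⟨l, a | a, b⟩
      · exact Or.inl ⟨l, a, b⟩
      · exact Or.inr ⟨l, a, b⟩

theorem SA_inter {m : ℕ} {A B : Set (Fin m → ℝ)} (hA : IsSemiArithmetic A)
    (hB : IsSemiArithmetic B) : IsSemiArithmetic (A ∩ B) := by
  obtain ⟨L, h, rfl⟩ := (isSA_iff _).1 hA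
  obtain ⟨L', h', rfl⟩ := (isSA_iff _).1 hB
  refine (isSA_iff _).2 ⟨(L ×ˢ L').map fun a => a.1 ++ a.2, ?_, ?_⟩
  · intro l hl c hc
    obtain ⟨⟨a, b⟩, hab, rfl⟩ := List.mem_map.1 hl
    have hab := List.pair_mem_product.1 hab
    rcases List.mem_append.1 hc with h1 | h1
    · exact h _ hab.1 c h1
    · exact h' _ hab.2 c h1
  · ext x
    constructor
    · rintro ⟨⟨l, a, b⟩, ⟨l', a', b'⟩⟩
      refine ⟨l ++ l', List.mem_map.2 ⟨(l, l'), List.pair_mem_product.2 ⟨a, a'⟩, rfl⟩, ?_⟩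
      intro c hc
      rcases List.mem_append.1 hc with h1 | h1
      · exact b c h1
      · exact b' c h1
    · rintro ⟨l, hl, hc⟩
      obtain ⟨⟨a, b⟩, hab, rfl⟩ := List.mem_map.1 hl
      have hab := List.pair_mem_product.1 hab
      exact ⟨⟨a, hab.1, fun c h => hc c (List.mem_append.2 (Or.inl h))⟩,
        ⟨b, hab.2, fun c h => hc c (List.mem_append.2 (Or.inr h))⟩⟩

theorem AlgC_iff {m : ℕ} {p : MvPolynomial (Fin m) ℝ} : AlgC p ↔
    ∃ p' : MvPolynomial (Fin m) (algebraicClosure ℚ ℝ),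
      MvPolynomial.map (algebraMap (algebraicClosure ℚ ℝ) ℝ) p' = p := by
  constructor
  · intro h
    have := (MvPolynomial.mem_range_map_iff_coeffs_subset
      (f := algebraMap (algebraicClosure ℚ ℝ) ℝ) (x := p)).2 (by
      intro c hc
      obtain ⟨d, hd, rfl⟩ := MvPolynomial.mem_coeffs_iff.1 hc
      exact ⟨⟨_, mem_algebraicClosure_iff.2 (h d)⟩, rfl⟩)
    exact this
  · rintro ⟨p', rfl⟩ d
    rw [MvPolynomial.coeff_map]
    exact mem_algebraicClosure_iff.1 (p'.coeff d).2

section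
variable {m : ℕ} {p q : MvPolynomial (Fin m) ℝ}
theorem AlgC.add (hp : AlgC p) (hq : AlgC q) : AlgC (p + q) := by
  obtain ⟨p, rfl⟩ := AlgC_iff.1 hp
  obtain ⟨q, rfl⟩ := AlgC_iff.1 hq
  exact AlgC_iff.2 ⟨p + q, by simp⟩
theorem AlgC.mul (hp : AlgC p) (hq : AlgC q) : AlgC (p * q) := by
  obtain ⟨p, rfl⟩ := AlgC_iff.1 hp
  obtain ⟨q, rfl⟩ := AlgC_iff.1 hq
  exact AlgC_iff.2 ⟨p * q, by simp⟩
theorem AlgC.sub (hp : AlgC p) (hq : AlgC q) : AlgC (p - q) := by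
  obtain ⟨p, rfl⟩ := AlgC_iff.1 hp
  obtain ⟨q, rfl⟩ := AlgC_iff.1 hq
  exact AlgC_iff.2 ⟨p - q, by simp⟩
theorem AlgC.neg (hp : AlgC p) : AlgC (-p) := by
  obtain ⟨p, rfl⟩ := AlgC_iff.1 hp
  exact AlgC_iff.2 ⟨-p, by simp⟩
theorem AlgC.pow (hp : AlgC p) (k : ℕ) : AlgC (p ^ k) := by
  obtain ⟨p, rfl⟩ := AlgC_iff.1 hp
  exact AlgC_iff.2 ⟨p ^ k, by simp⟩
theorem AlgC.C {c : ℝ} (hc : IsAlgebraic ℚ c) : AlgC (MvPolynomial.C c : MvPolynomial (Fin m) ℝ) :=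
  AlgC_iff.2 ⟨MvPolynomial.C ⟨c, mem_algebraicClosure_iff.2 hc⟩, by simp⟩
theorem AlgC.X (i : Fin m) : AlgC (MvPolynomial.X i : MvPolynomial (Fin m) ℝ) :=
  AlgC_iff.2 ⟨MvPolynomial.X i, by simp⟩
theorem AlgC.nat (k : ℕ) : AlgC (k : MvPolynomial (Fin m) ℝ) :=
  AlgC_iff.2 ⟨k, by simp⟩
theorem AlgC.rename {k : ℕ} (e : Fin m → Fin k) (hp : AlgC p) :
    AlgC (MvPolynomial.rename e p) := by
  obtain ⟨p, rfl⟩ := AlgC_iff.1 hp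
  exact AlgC_iff.2 ⟨MvPolynomial.rename e p, by rw [MvPolynomial.map_rename]⟩
end

theorem SA_preimage {m k : ℕ} (e : Fin m → Fin k) {A : Set (Fin m → ℝ)}
    (hA : IsSemiArithmetic A) : IsSemiArithmetic {x : Fin k → ℝ | x ∘ e ∈ A} := by
  obtain ⟨L, h, rfl⟩ := (isSA_iff _).1 hA
  refine (isSA_iff _).2 ⟨L.map fun l => l.map fun c => (MvPolynomial.rename e c.1, c.2), ?_, ?_⟩
  · intro l hl c hc
    obtain ⟨l, hl', rfl⟩ := List.mem_map.1 hl
    obtain ⟨c, hc', rfl⟩ := List.mem_map.1 hc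
    exact (h l hl' c hc').rename e
  · ext x
    constructor
    · rintro ⟨l, hl, hc⟩
      refine ⟨_, List.mem_map.2 ⟨l, hl, rfl⟩, fun c' hc' => ?_⟩
      obtain ⟨c, hc1, rfl⟩ := List.mem_map.1 hc'
      have := hc c hc1
      simpa only [SAHolds, MvPolynomial.eval_rename] using this
    · rintro ⟨l', hl', hc⟩
      obtain ⟨l, hl, rfl⟩ := List.mem_map.1 hl'
      refine ⟨l, hl, fun c hc1 => ?_⟩
      have := hc _ (List.mem_map.2 ⟨c, hc1, rfl⟩)
      simpa only [SAHolds, MvPolynomial.eval_rename] using this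

theorem measurable_eval {m : ℕ} (p : MvPolynomial (Fin m) ℝ) :
    Measurable fun x : Fin m → ℝ => MvPolynomial.eval x p :=
  (MvPolynomial.continuous_eval p).measurable

theorem SA_measurable {m : ℕ} {A : Set (Fin m → ℝ)} (hA : IsSemiArithmetic A) :
    MeasurableSet A := by
  obtain ⟨k, l, p, b, h, rfl⟩ := hA
  refine MeasurableSet.iUnion fun i => MeasurableSet.iInter fun j => ?_
  split_ifs
  · exact measurable_eval _ (measurableSet_singleton 0)
  · exact measurable_eval _ measurableSet_Ioi


theorem fub {m : ℕ} (i : Fin (m + 1)) (S : Set (Fin m → ℝ)) (T : (Fin m → ℝ) → Set ℝ)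
    (W : Set (Fin (m + 1) → ℝ)) (G : (Fin (m + 1) → ℝ) → ℝ) (A B : (Fin m → ℝ) → ℝ)
    (hS : MeasurableSet S) (hT : ∀ x ∈ S, MeasurableSet (T x))
    (hWm : MeasurableSet W) (hG : Measurable G)
    (hW : ∀ x t, i.insertNth t x ∈ W ↔ x ∈ S ∧ t ∈ T x)
    (h1 : ∀ x ∈ S, IntegrableOn (fun t => G (i.insertNth t x)) (T x))
    (hA : ∀ x ∈ S, ∫ t in T x, G (i.insertNth t x) = A x)
    (hB : ∀ x ∈ S, ∫ t in T x, |G (i.insertNth t x)| = B x)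
    (hBi : IntegrableOn B S) :
    IntegrableOn G W ∧ ∫ z in W, G z = ∫ x in S, A x := by
  classical
  have hmp := volume_preserving_piFinSuccAbove (fun _ : Fin (m + 1) => ℝ) i
  set e := MeasurableEquiv.piFinSuccAbove (fun _ : Fin (m + 1) => ℝ) i with he
  have hes : ∀ t x, e.symm (t, x) = i.insertNth t x := fun t x => rfl
  let H : ℝ × (Fin m → ℝ) → ℝ := fun y => W.indicator G (e.symm y)
  have hHm : Measurable H := (hG.indicator hWm).comp e.symm.measurable
  have hH : ∀ x t, H (t, x) = if x ∈ S then (T x).indicator (fun t => G (i.insertNth t x)) t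
      else 0 := by
    intro x t
    simp only [H, hes, Set.indicator_apply, hW]
    by_cases hx : x ∈ S <;> simp [hx]
  have hHe : W.indicator G = H ∘ e := by
    ext z
    simp [H]
  have hHn : ∀ x, (∫ t, ‖H (t, x)‖) = S.indicator B x := by
    intro x
    by_cases hx : x ∈ S
    · simp only [hH, hx, if_true, norm_indicator_eq_indicator_norm, Set.indicator_of_mem]
      rw [integral_indicator (hT x hx), ← hB x hx]
      rfl
    · simp [hH, hx]
  have hint : Integrable H (volume.prod volume) := by
    rw [integrable_prod_iff' hHm.aestronglyMeasurable]
    refine ⟨Filter.Eventually.of_forall fun x => ?_, ?_⟩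
    · by_cases hx : x ∈ S
      · simp only [hH, hx, if_true]
        exact (h1 x hx).integrable_indicator (hT x hx)
      · simp [hH, hx]
    · simp only [hHn]
      exact hBi.integrable_indicator hS
  have hint' : Integrable (W.indicator G) := by
    rw [hHe]
    exact (hmp.integrable_comp_emb e.measurableEmbedding).2 hint
  refine ⟨(integrable_indicator_iff hWm).1 hint', ?_⟩
  rw [← integral_indicator hWm, hHe]
  have := hmp.integral_comp e.measurableEmbedding H
  simp only [Function.comp_def]
  rw [this, show (volume : Measure (ℝ × (Fin m → ℝ))) = volume.prod volume from rfl,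
    integral_prod_symm _ hint, ← integral_indicator hS]
  congr 1
  ext x
  by_cases hx : x ∈ S
  · simp only [hH, hx, if_true, Set.indicator_of_mem]
    rw [integral_indicator (hT x hx), hA x hx]
  · simp [hH, hx]

theorem insertNth_comp {m : ℕ} (i : Fin (m + 1)) (t : ℝ) (x : Fin m → ℝ) :
    (i.insertNth t x : Fin (m + 1) → ℝ) ∘ i.succAbove = x := by
  ext j; simp

theorem SA_cyl {m : ℕ} (i : Fin (m + 1)) {S : Set (Fin m → ℝ)} (hS : IsSemiArithmetic S)
    (a : ℕ) : IsSemiArithmetic {z : Fin (m + 1) → ℝ | z ∘ i.succAbove ∈ S ∧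
      z i ∈ Set.Ioo (a : ℝ) (a + 1)} := by
  have h1 := SA_pos ((AlgC.X i).sub (AlgC.nat (m := m + 1) a))
  have h2 := SA_pos ((AlgC.nat (m := m + 1) (a + 1)).sub (AlgC.X i))
  have := SA_inter (SA_preimage i.succAbove hS) (SA_inter h1 h2)
  convert! this using 1
  ext z
  simp [Set.mem_Ioo]

theorem cyl_int {m : ℕ} (i : Fin (m + 1)) {S : Set (Fin m → ℝ)} (hS : IsSemiArithmetic S)
    (a : ℕ) (A : (Fin m → ℝ) → ℝ) (hA : Measurable A) (hAi : IntegrableOn A S) :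
    IntegrableOn (fun z => A (z ∘ i.succAbove)) {z : Fin (m + 1) → ℝ | z ∘ i.succAbove ∈ S ∧
      z i ∈ Set.Ioo (a : ℝ) (a + 1)} ∧ ∫ z in {z : Fin (m + 1) → ℝ | z ∘ i.succAbove ∈ S ∧
      z i ∈ Set.Ioo (a : ℝ) (a + 1)}, A (z ∘ i.succAbove) = ∫ x in S, A x := by
  refine fub i S (fun _ => Set.Ioo (a : ℝ) (a + 1)) _ _ A (fun x => |A x|) (SA_measurable hS)
    (fun _ _ => measurableSet_Ioo) (SA_measurable (SA_cyl i hS a)) ?_ ?_ ?_ ?_ ?_ hAi.abs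
  · exact hA.comp (measurable_pi_lambda _ fun j => measurable_pi_apply _)
  · intro x t
    simp
  · intro x _
    simp only [insertNth_comp]
    exact integrableOn_const (by simp)
  · intro x _
    simp
  · intro x _
    simp

/-- normal form -/
def NF (m : ℕ) (x : ℝ) : Prop := ∃ S : Set (Fin (m + 1) → ℝ), IsSemiArithmetic S ∧
  IntegrableOn (fun z => 2 * z 0) S ∧ x = ∫ z in S, 2 * z 0

theorem NF.succ {m : ℕ} {x : ℝ} (h : NF m x) : NF (m + 1) x := by
  obtain ⟨S, hS, hi, rfl⟩ := h
  have := cyl_int (Fin.last (m + 1)) hS 0 (fun z => 2 * z 0) (by fun_prop) hi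
  exact ⟨_, SA_cyl (Fin.last (m + 1)) hS 0, by simpa using! this.1, by simpa using! this.2.symm⟩

theorem NF.le {m k : ℕ} {x : ℝ} (h : NF m x) (hk : m ≤ k) : NF k x := by
  induction k, hk using Nat.le_induction with
  | base => exact h
  | succ k _ ih => exact ih.succ

theorem NF.add {m : ℕ} {x y : ℝ} (hx : NF m x) (hy : NF m y) : NF (m + 1) (x + y) := by
  obtain ⟨S, hS, hi, rfl⟩ := hx
  obtain ⟨S', hS', hi', rfl⟩ := hy
  have h1 := cyl_int (Fin.last (m + 1)) hS 0 (fun z => 2 * z 0) (by fun_prop) hi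
  have h2 := cyl_int (Fin.last (m + 1)) hS' 1 (fun z => 2 * z 0) (by fun_prop) hi'
  have e1 := SA_cyl (Fin.last (m + 1)) hS 0
  have e2 := SA_cyl (Fin.last (m + 1)) hS' 1
  refine ⟨_, SA_union e1 e2, ?_, ?_⟩
  · exact IntegrableOn.union (by simpa using! h1.1) (by simpa using! h2.1)
  · rw [← h1.2, ← h2.2]
    symm
    refine setIntegral_union ?_ (SA_measurable e2) (by simpa using! h1.1) (by simpa using! h2.1)
    rw [Set.disjoint_left]
    rintro z ⟨_, h⟩ ⟨_, h'⟩
    simp only [Set.mem_Ioo, Nat.cast_zero, Nat.cast_one] at h h'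
    linarith [h.2, h'.1]

theorem NF.period {m : ℕ} {x : ℝ} (h : NF m x) : IsRealPeriod x := by
  obtain ⟨S, hS, hi, rfl⟩ := h
  exact ⟨m + 1, S, ((2 : ℕ) : MvPolynomial (Fin (m + 1)) ℝ) * MvPolynomial.X 0, 1, hS, (AlgC.nat 2).mul (AlgC.X 0),
    by simpa using! AlgC.nat (m := m + 1) 1, by simpa using hi, by simp⟩

def TT (A : ℝ) : Set ℝ := {t | (0 < t ∧ t ^ 2 < A) ∨ (t < 0 ∧ t ^ 2 < -A)}

theorem TT_pos {A : ℝ} (h : 0 ≤ A) : TT A = Set.Ioo 0 (√A) := by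
  ext t
  simp only [TT, Set.mem_ofPred_eq, Set.mem_Ioo]
  constructor
  · rintro (⟨h1, h2⟩ | ⟨h1, h2⟩)
    · exact ⟨h1, Real.lt_sqrt_of_sq_lt h2⟩
    · nlinarith
  · rintro ⟨h1, h2⟩
    exact Or.inl ⟨h1, (Real.lt_sqrt h1.le).1 h2⟩

theorem TT_neg {A : ℝ} (h : A ≤ 0) : TT A = Set.Ioo (-√(-A)) 0 := by
  ext t
  simp only [TT, Set.mem_ofPred_eq, Set.mem_Ioo]
  constructor
  · rintro (⟨h1, h2⟩ | ⟨h1, h2⟩)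
    · nlinarith
    · refine ⟨?_, h1⟩
      have : -t < √(-A) := Real.lt_sqrt_of_sq_lt (by nlinarith)
      linarith
  · rintro ⟨h1, h2⟩
    have : -t < √(-A) := by linarith
    have := (Real.lt_sqrt (by linarith : 0 ≤ -t)).1 this
    exact Or.inr ⟨h2, by nlinarith⟩

theorem TT_int (A : ℝ) : MeasurableSet (TT A) ∧ IntegrableOn (fun t => 2 * t) (TT A) ∧
    ∫ t in TT A, 2 * t = A ∧ ∫ t in TT A, |2 * t| = |A| := by
  rcases le_total 0 A with h | h
  · rw [TT_pos h]
    have e : ∫ t in Set.Ioo 0 (√A), 2 * t = A := by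
      rw [← integral_Ioc_eq_integral_Ioo, ← intervalIntegral.integral_of_le (Real.sqrt_nonneg _)]
      rw [intervalIntegral.integral_const_mul, integral_id]
      rw [Real.sq_sqrt h]; ring
    refine ⟨measurableSet_Ioo, ?_, e, ?_⟩
    · exact ((by fun_prop : Continuous fun t : ℝ => 2 * t).integrableOn_Icc).mono_set
        Set.Ioo_subset_Icc_self
    · rw [abs_of_nonneg h]
      nth_rw 2 [← e]
      refine setIntegral_congr_fun measurableSet_Ioo fun t ht => ?_
      exact abs_of_pos (by linarith [ht.1])
  · rw [TT_neg h]
    have e : ∫ t in Set.Ioo (-√(-A)) 0, 2 * t = A := by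
      rw [← integral_Ioc_eq_integral_Ioo,
        ← intervalIntegral.integral_of_le (by linarith [Real.sqrt_nonneg (-A)])]
      rw [intervalIntegral.integral_const_mul, integral_id]
      rw [neg_sq, Real.sq_sqrt (by linarith)]; ring
    refine ⟨measurableSet_Ioo, ?_, e, ?_⟩
    · exact ((by fun_prop : Continuous fun t : ℝ => 2 * t).integrableOn_Icc).mono_set
        Set.Ioo_subset_Icc_self
    · rw [abs_of_nonpos h]
      nth_rw 2 [← e]
      rw [← integral_neg]
      refine setIntegral_congr_fun measurableSet_Ioo fun t ht => ?_
      exact abs_of_neg (by linarith [ht.2])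

theorem div_aux (P Q t : ℝ) : 0 < P * Q - t ^ 2 * Q ^ 2 ↔ t ^ 2 < P / Q := by
  by_cases hQ : Q = 0
  · subst hQ
    simp only [mul_zero, ne_eq, OfNat.ofNat_ne_zero, not_false_eq_true, zero_pow, sub_self,
      lt_self_iff_false, div_zero, false_iff, not_lt]
    positivity
  · have hQ2 : 0 < Q ^ 2 := by positivity
    have : P / Q = P * Q / Q ^ 2 := by field_simp
    rw [this, lt_div_iff₀ hQ2]
    constructor <;> intro h <;> linarith

theorem IsRealPeriod.nf {x : ℝ} (h : IsRealPeriod x) : ∃ m, NF m x := by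
  obtain ⟨m, C, p, q, hC, hp, hq, hi, rfl⟩ := h
  let p' := MvPolynomial.rename (Fin.succAbove (0 : Fin (m + 1))) p
  let q' := MvPolynomial.rename (Fin.succAbove (0 : Fin (m + 1))) q
  have hp' : AlgC p' := AlgC.rename _ hp
  have hq' : AlgC q' := AlgC.rename _ hq
  let X0 : MvPolynomial (Fin (m + 1)) ℝ := MvPolynomial.X 0
  have hX : AlgC X0 := AlgC.X 0
  have hSA := SA_inter (SA_preimage (Fin.succAbove (0 : Fin (m + 1))) hC)
    (SA_union (SA_inter (SA_pos hX) (SA_pos ((hp'.mul hq').sub ((hX.pow 2).mul (hq'.pow 2)))))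
      (SA_inter (SA_pos hX.neg) (SA_pos ((hp'.neg.mul hq').sub ((hX.pow 2).mul (hq'.pow 2))))))
  refine ⟨m, _, hSA, ?_⟩
  have := fub (0 : Fin (m + 1)) C
    (fun x => TT (MvPolynomial.eval x p / MvPolynomial.eval x q)) _ (fun z => 2 * z 0)
    (fun x => MvPolynomial.eval x p / MvPolynomial.eval x q)
    (fun x => |MvPolynomial.eval x p / MvPolynomial.eval x q|) (SA_measurable hC)
    (fun x _ => (TT_int _).1) (SA_measurable hSA) (by fun_prop) ?_ ?_ ?_ ?_ hi.abs
  · exact ⟨this.1, this.2.symm⟩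
  · intro x t
    have hx : ∀ r : MvPolynomial (Fin m) ℝ, MvPolynomial.eval
        ((0 : Fin (m + 1)).insertNth t x : Fin (m + 1) → ℝ)
        (MvPolynomial.rename (Fin.succAbove (0 : Fin (m + 1))) r) = MvPolynomial.eval x r := by
      intro r
      rw [MvPolynomial.eval_rename, insertNth_comp]
    simp only [Set.mem_inter_iff, Set.mem_union, Set.mem_ofPred_eq, insertNth_comp, TT,
      p', q', X0, map_mul, map_sub, map_neg, map_pow, hx, MvPolynomial.eval_X, div_aux,
      Fin.insertNth_apply_same, neg_pos, neg_div]
  · intro x _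
    simpa using (TT_int _).2.1
  · intro x _
    simpa using (TT_int _).2.2.1
  · intro x _
    simpa using (TT_int _).2.2.2

theorem IsRealPeriod.add {x y : ℝ} (hx : IsRealPeriod x) (hy : IsRealPeriod y) :
    IsRealPeriod (x + y) := by
  obtain ⟨m, hm⟩ := hx.nf
  obtain ⟨k, hk⟩ := hy.nf
  exact ((hm.le (le_max_left m k)).add (hk.le (le_max_right m k))).period

theorem IsRealPeriod.smul {x c : ℝ} (hc : IsAlgebraic ℚ c) (hx : IsRealPeriod x) :
    IsRealPeriod (c * x) := by
  obtain ⟨m, C, p, q, hC, hp, hq, hi, rfl⟩ := hx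
  refine ⟨m, C, MvPolynomial.C c * p, q, hC, (AlgC.C hc).mul hp, hq, ?_, ?_⟩
  · simp only [map_mul, MvPolynomial.eval_C, mul_div_assoc]
    exact hi.const_mul c
  · simp only [map_mul, MvPolynomial.eval_C, mul_div_assoc]
    rw [integral_const_mul]

theorem IsRealPeriod.zero : IsRealPeriod 0 :=
  ⟨0, {x | 0 < MvPolynomial.eval x (0 : MvPolynomial (Fin 0) ℝ)}, 0, 1,
    SA_pos (by simpa using AlgC.nat (m := 0) 0), fun d => by simpa using isAlgebraic_zero,
    by simpa using! AlgC.nat (m := 0) 1, by simp, by simp⟩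

/-- complex periods as a module over the real algebraic numbers -/
def Per : Submodule (algebraicClosure ℚ ℝ) ℂ where
  carrier := {z | IsPeriod z}
  add_mem' := fun {a b} ha hb => ⟨by simpa using ha.1.add hb.1, by simpa using ha.2.add hb.2⟩
  zero_mem' := ⟨by simpa using IsRealPeriod.zero, by simpa using IsRealPeriod.zero⟩
  smul_mem' := fun c z hz => by
    have hc : IsAlgebraic ℚ (c : ℝ) := mem_algebraicClosure_iff.1 c.2
    have : c • z = ((c : ℝ) : ℂ) * z := by
      rw [Algebra.smul_def]; rfl
    refine ⟨?_, ?_⟩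
    · rw [this, Complex.re_ofReal_mul]
      exact hz.1.smul hc
    · rw [this, Complex.im_ofReal_mul]
      exact hz.2.smul hc


theorem log_1d {p q : ℝ} (h : 0 < p / q) :
    IntegrableOn (fun t => (p - q) / (q + t * (p - q))) (Set.Ioo 0 1) ∧
    ∫ t in Set.Ioo (0 : ℝ) 1, (p - q) / (q + t * (p - q)) = Real.log (p / q) ∧
    ∫ t in Set.Ioo (0 : ℝ) 1, |(p - q) / (q + t * (p - q))| = |Real.log (p / q)| := by
  have hq : q ≠ 0 := by rintro rfl; simp at h
  set f := p / q with hf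
  have hpq : p = f * q := by rw [hf]; field_simp
  have hD : ∀ t ∈ Set.Icc (0 : ℝ) 1, 0 < 1 + t * (f - 1) := by
    intro t ht
    have : 1 + t * (f - 1) = (1 - t) + t * f := by ring
    rw [this]
    rcases ht.1.eq_or_lt with h0 | h0
    · rw [← h0]; norm_num
    · have := mul_pos h0 h
      linarith [ht.2]
  have he : ∀ t, (p - q) / (q + t * (p - q)) = (f - 1) / (1 + t * (f - 1)) := by
    intro t
    rw [hpq, show f * q - q = q * (f - 1) by ring, show q + t * (q * (f - 1)) =
      q * (1 + t * (f - 1)) by ring, mul_div_mul_left _ _ hq]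
  simp only [he]
  have hc : ContinuousOn (fun t => (f - 1) / (1 + t * (f - 1))) (Set.Icc 0 1) :=
    ContinuousOn.div (by fun_prop) (by fun_prop) fun t ht => (hD t ht).ne'
  have e : ∫ t in Set.Ioo (0 : ℝ) 1, (f - 1) / (1 + t * (f - 1)) = Real.log f := by
    rw [← integral_Ioc_eq_integral_Ioo, ← intervalIntegral.integral_of_le zero_le_one]
    rw [intervalIntegral.integral_eq_sub_of_hasDerivAt
      (f := fun t => Real.log (1 + t * (f - 1)))]
    · simp
    · intro t ht
      rw [Set.uIcc_of_le zero_le_one] at ht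
      have h1 : HasDerivAt (fun t => 1 + t * (f - 1)) (f - 1) t := by
        simpa using ((hasDerivAt_id t).mul_const (f - 1)).const_add 1
      exact h1.log (hD t ht).ne'
    · apply ContinuousOn.intervalIntegrable
      rwa [Set.uIcc_of_le zero_le_one]
  refine ⟨(hc.integrableOn_compact isCompact_Icc).mono_set Set.Ioo_subset_Icc_self, e, ?_⟩
  rcases le_total 1 f with h1 | h1
  · rw [abs_of_nonneg (Real.log_nonneg h1), ← e]
    refine setIntegral_congr_fun measurableSet_Ioo fun t ht => ?_
    exact abs_of_nonneg (div_nonneg (by linarith) (hD t (Set.Ioo_subset_Icc_self ht)).le)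
  · rw [abs_of_nonpos (Real.log_nonpos h.le h1), ← e, ← integral_neg]
    refine setIntegral_congr_fun measurableSet_Ioo fun t ht => ?_
    exact abs_of_nonpos (div_nonpos_of_nonpos_of_nonneg (by linarith)
      (hD t (Set.Ioo_subset_Icc_self ht)).le)

theorem log_period (k : ℕ) : ∀ (m : ℕ) (C : Set (Fin m → ℝ)) (P Q p q : MvPolynomial (Fin m) ℝ),
    IsSemiArithmetic C → AlgC P → AlgC Q → AlgC p → AlgC q →
    (∀ x ∈ C, 0 < MvPolynomial.eval x p / MvPolynomial.eval x q) →
    IntegrableOn (fun x => MvPolynomial.eval x P / MvPolynomial.eval x Q *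
      Real.log (MvPolynomial.eval x p / MvPolynomial.eval x q) ^ k) C →
    IsRealPeriod (∫ x in C, MvPolynomial.eval x P / MvPolynomial.eval x Q *
      Real.log (MvPolynomial.eval x p / MvPolynomial.eval x q) ^ k) := by
  induction k with
  | zero =>
    intro m C P Q p q hC hP hQ hp hq hpos hi
    simp only [pow_zero, mul_one] at hi ⊢
    exact ⟨m, C, P, Q, hC, hP, hQ, hi, rfl⟩
  | succ k ih =>
    intro m C P Q p q hC hP hQ hp hq hpos hi
    let e : Fin m → Fin (m + 1) := Fin.succAbove 0
    let r := MvPolynomial.rename (R := ℝ) e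
    have key := fub (0 : Fin (m + 1)) C (fun _ => Set.Ioo ((0 : ℕ) : ℝ) ((0 : ℕ) + 1)) _
      (fun z => MvPolynomial.eval z (r P * (r p - r q)) /
        MvPolynomial.eval z (r Q * (r q + MvPolynomial.X 0 * (r p - r q))) *
        Real.log (MvPolynomial.eval z (r p) / MvPolynomial.eval z (r q)) ^ k)
      (fun x => MvPolynomial.eval x P / MvPolynomial.eval x Q *
        Real.log (MvPolynomial.eval x p / MvPolynomial.eval x q) ^ (k + 1))
      (fun x => |MvPolynomial.eval x P / MvPolynomial.eval x Q *
        Real.log (MvPolynomial.eval x p / MvPolynomial.eval x q) ^ (k + 1)|)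
      (SA_measurable hC) (fun _ _ => measurableSet_Ioo) (SA_measurable (SA_cyl 0 hC 0))
      (((measurable_eval _).div (measurable_eval _)).mul
        ((Real.measurable_log.comp ((measurable_eval _).div (measurable_eval _))).pow_const k))
      (by intro x t; simp) ?_ ?_ ?_ hi.abs
    · rw [← key.2]
      refine ih (m + 1) _ _ _ _ _ (SA_cyl 0 hC 0) ((hP.rename e).mul ((hp.rename e).sub
        (hq.rename e))) ((hQ.rename e).mul ((hq.rename e).add ((AlgC.X 0).mul
        ((hp.rename e).sub (hq.rename e))))) (hp.rename e) (hq.rename e) ?_ key.1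
      intro z hz
      rw [MvPolynomial.eval_rename, MvPolynomial.eval_rename]
      exact hpos _ hz.1
    all_goals
      intro x hx
      have hr : ∀ (t : ℝ) (s : MvPolynomial (Fin m) ℝ), MvPolynomial.eval
          ((0 : Fin (m + 1)).insertNth t x : Fin (m + 1) → ℝ) (r s) = MvPolynomial.eval x s := by
        intro t s
        simp only [r, e]
        rw [MvPolynomial.eval_rename, insertNth_comp]
      obtain ⟨l1, l2, l3⟩ := log_1d (hpos x hx)
      have hre : ∀ a b c d t : ℝ, a * (c - d) / (b * (d + t * (c - d))) =
        a / b * ((c - d) / (d + t * (c - d))) := fun a b c d t => mul_div_mul_comm _ _ _ _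
      simp only [map_mul, map_sub, map_add, hr, MvPolynomial.eval_X, Fin.insertNth_apply_same, hre,
        Nat.cast_zero, zero_add, abs_mul]
    · exact (l1.const_mul _).mul_const _
    · rw [integral_mul_const, integral_const_mul, l2, pow_succ]
      ring
    · rw [integral_mul_const, integral_const_mul, l3, abs_pow, abs_pow, pow_succ]
      ring

theorem null_zero : ∀ (n : ℕ) (p : MvPolynomial (Fin n) ℝ), p ≠ 0 →
    volume {x : Fin n → ℝ | MvPolynomial.eval x p = 0} = 0 := by
  intro n
  induction n with
  | zero =>
    intro p hp
    have : {x : Fin 0 → ℝ | MvPolynomial.eval x p = 0} = ∅ := by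
      ext x
      simp only [Set.mem_ofPred_eq, Set.mem_empty_iff_false, iff_false]
      intro h
      apply hp
      rw [MvPolynomial.eq_C_of_isEmpty p] at h ⊢
      rw [MvPolynomial.eval_C] at h
      rw [h, map_zero]
    rw [this, measure_empty]
  | succ n ih =>
    intro p hp
    have hmp := volume_preserving_piFinSuccAbove (fun _ : Fin (n + 1) => ℝ) 0
    set e := MeasurableEquiv.piFinSuccAbove (fun _ : Fin (n + 1) => ℝ) 0 with he
    have hms : MeasurableSet {x : Fin (n + 1) → ℝ | MvPolynomial.eval x p = 0} :=
      measurable_eval p (measurableSet_singleton 0)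
    have h2 := (hmp.symm e).measure_preimage hms.nullMeasurableSet
    rw [← h2]
    change (volume.prod volume) _ = 0
    rw [Measure.prod_apply_symm (e.symm.measurable hms)]
    have hp' : MvPolynomial.finSuccEquiv ℝ n p ≠ 0 := by simpa using hp
    obtain ⟨k, hk⟩ : ∃ k, (MvPolynomial.finSuccEquiv ℝ n p).coeff k ≠ 0 := by
      by_contra! h
      exact hp' (Polynomial.ext (by simpa using h))
    have hae : ∀ᵐ y : Fin n → ℝ, volume ((fun x : ℝ => (x, y)) ⁻¹'
        (e.symm ⁻¹' {x : Fin (n + 1) → ℝ | MvPolynomial.eval x p = 0})) = 0 := by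
      have h0 := ih _ hk
      rw [← compl_compl {x : Fin n → ℝ | _}] at h0
      filter_upwards [mem_ae_iff.2 h0] with y hy
      have hne : Polynomial.map (MvPolynomial.eval y) (MvPolynomial.finSuccEquiv ℝ n p) ≠ 0 := by
        intro h
        apply hy
        have := congrArg (fun P => Polynomial.coeff P k) h
        simpa using this
      refine measure_mono_null ?_ ((Polynomial.finite_setOfPred_isRoot hne).measure_zero volume)
      intro t ht
      have ht' : MvPolynomial.eval (Fin.cons t y : Fin (n + 1) → ℝ) p = 0 := by
        have : (Fin.cons t y : Fin (n + 1) → ℝ) = e.symm (t, y) := by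
          ext j
          simp [he, Fin.insertNth_zero]
        rw [this]
        exact ht
      rw [MvPolynomial.eval_eq_eval_mv_eval'] at ht'
      exact ht'
    rw [lintegral_congr_ae hae, lintegral_zero]


section Alg
open MvPolynomial

variable {A : Type*} [CommRing A] {n : ℕ}

def Dop (s l : A) (H : MvPolynomial (Fin n) A) (G : Fin n → MvPolynomial (Fin n) A)
    (j : Fin n) (k : ℕ) (a : MvPolynomial (Fin n) A) : MvPolynomial (Fin n) A :=
  H * pderiv j a + C (l - k) * (a * pderiv j H) + C s * (a * G j)

def DL (s l : A) (H : MvPolynomial (Fin n) A) (G : Fin n → MvPolynomial (Fin n) A)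
    (k : ℕ) : List (Fin n) → MvPolynomial (Fin n) A → MvPolynomial (Fin n) A
  | [], a => a
  | j :: L, a => Dop s l H G j (k + L.length) (DL s l H G k L a)

def pdL : List (Fin n) → MvPolynomial (Fin n) A → MvPolynomial (Fin n) A
  | [], m => m
  | j :: L, m => pdL L (pderiv j m)

theorem Dop_mul (s l : A) (H : MvPolynomial (Fin n) A) (G : Fin n → MvPolynomial (Fin n) A)
    (j : Fin n) (k : ℕ) (m a : MvPolynomial (Fin n) A) :
    m * Dop s l H G j k a = Dop s l H G j k (m * a) - H * (pderiv j m * a) := by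
  simp only [Dop, Derivation.leibniz, smul_eq_mul]
  ring

theorem T_DL (s l : A) (H : MvPolynomial (Fin n) A) (G : Fin n → MvPolynomial (Fin n) A)
    (K : ℕ) (T : MvPolynomial (Fin n) A →ₗ[A] A)
    (hT : ∀ k < K, ∀ j b, T (H ^ (K - (k + 1)) * Dop s l H G j k b) = 0)
    (k : ℕ) (L : List (Fin n)) : ∀ (m a : MvPolynomial (Fin n) A), k + L.length ≤ K →
    T (H ^ (K - (k + L.length)) * (m * DL s l H G k L a)) =
      (-1) ^ L.length * T (H ^ (K - k) * (pdL L m * a)) := by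
  induction L with
  | nil => intro m a _; simp [DL, pdL]
  | cons j L ih =>
    intro m a hL
    simp only [List.length_cons] at hL ⊢
    have h1 := ih (pderiv j m) a (by omega)
    have h2 := hT (k + L.length) (by omega) j (m * DL s l H G k L a)
    simp only [DL, pdL]
    rw [Dop_mul, mul_sub, map_sub, show k + (L.length + 1) = k + L.length + 1 by ring, h2,
      ← mul_assoc, ← pow_succ, show K - (k + L.length + 1) + 1 = K - (k + L.length) by omega, h1]
    ring

theorem pdL_zero (L : List (Fin n)) : pdL L (0 : MvPolynomial (Fin n) A) = 0 := by
  induction L with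
  | nil => rfl
  | cons j L ih => simp [pdL, ih]

theorem pdL_of_lt (L : List (Fin n)) : ∀ (α : Fin n →₀ ℕ) (c : A), (∃ j, α j < L.count j) →
    pdL L (monomial α c) = 0 := by
  induction L with
  | nil => rintro α c ⟨j, hj⟩; simp at hj
  | cons i L ih =>
    rintro α c ⟨j, hj⟩
    simp only [pdL, pderiv_monomial]
    by_cases h0 : α i = 0
    · simp [h0, pdL_zero]
    · refine ih _ _ ⟨j, ?_⟩
      rw [List.count_cons] at hj
      by_cases hij : i = j
      · subst hij
        simp at hj ⊢
        omega
      · simp [hij] at hj ⊢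
        exact hj

theorem pdL_of_eq (L : List (Fin n)) : ∀ (α : Fin n →₀ ℕ) (c : A), (∀ j, α j = L.count j) →
    ∃ m : ℕ, m ≠ 0 ∧ pdL L (monomial α c) = C (c * m) := by
  induction L with
  | nil =>
    intro α c h
    have : α = 0 := by ext j; simpa using h j
    refine ⟨1, one_ne_zero, ?_⟩
    simp [this, pdL]
  | cons i L ih =>
    intro α c h
    simp only [pdL, pderiv_monomial]
    obtain ⟨m, hm, e⟩ := ih (α - Finsupp.single i 1) (c * α i) (by
      intro j
      have := h j
      rw [List.count_cons] at this
      by_cases hij : i = j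
      · subst hij; simp at this ⊢; omega
      · simp [hij] at this ⊢; exact this)
    refine ⟨α i * m, mul_ne_zero ?_ hm, ?_⟩
    · rw [h i]; simp
    · rw [e]; push_cast; ring_nf

theorem totalDegree_pderiv (j : Fin n) (p : MvPolynomial (Fin n) A) :
    (pderiv j p).totalDegree ≤ p.totalDegree := by
  conv_lhs => rw [p.as_sum, map_sum]
  refine totalDegree_finsetSum_le fun d hd => ?_
  rw [pderiv_monomial]
  refine (totalDegree_monomial_le _ _).trans (le_trans ?_ (le_totalDegree hd))
  rw [Finsupp.sum_fintype _ _ (by simp), Finsupp.sum_fintype _ _ (by simp)]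
  exact Finset.sum_le_sum fun i _ => by simp

theorem totalDegree_Dop (s l : A) (H : MvPolynomial (Fin n) A)
    (G : Fin n → MvPolynomial (Fin n) A) (d : ℕ) (hH : H.totalDegree ≤ d)
    (hG : ∀ j, (G j).totalDegree ≤ d) (j : Fin n) (k : ℕ) (a : MvPolynomial (Fin n) A) :
    (Dop s l H G j k a).totalDegree ≤ a.totalDegree + d := by
  have h1 := totalDegree_pderiv j a
  have h2 := totalDegree_pderiv j H
  refine (totalDegree_add _ _).trans (max_le ((totalDegree_add _ _).trans (max_le ?_ ?_)) ?_)
  · refine (totalDegree_mul _ _).trans ?_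
    omega
  · refine (totalDegree_mul _ _).trans ?_
    have := totalDegree_mul a (pderiv j H)
    rw [totalDegree_C]; omega
  · refine (totalDegree_mul _ _).trans ?_
    have := totalDegree_mul a (G j)
    have := hG j
    rw [totalDegree_C]; omega

theorem totalDegree_DL (s l : A) (H : MvPolynomial (Fin n) A)
    (G : Fin n → MvPolynomial (Fin n) A) (d : ℕ) (hH : H.totalDegree ≤ d)
    (hG : ∀ j, (G j).totalDegree ≤ d) (k : ℕ) (L : List (Fin n)) (a : MvPolynomial (Fin n) A) :
    (DL s l H G k L a).totalDegree ≤ a.totalDegree + L.length * d := by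
  induction L with
  | nil => simp [DL]
  | cons j L ih =>
    refine (totalDegree_Dop s l H G d hH hG _ _ _).trans ?_
    rw [List.length_cons, add_mul]
    omega

theorem map_DL {A' : Type*} [CommRing A'] (φ : A →+* A') (s l : A) (H : MvPolynomial (Fin n) A)
    (G : Fin n → MvPolynomial (Fin n) A) (k : ℕ) (L : List (Fin n))
    (a : MvPolynomial (Fin n) A) : map φ (DL s l H G k L a) =
      DL (φ s) (φ l) (map φ H) (fun j => map φ (G j)) k L (map φ a) := by
  induction L with
  | nil => rfl
  | cons j L ih => simp [DL, Dop, ← ih, pderiv_map]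

def LL (β : Fin n → ℕ) : List (Fin n) :=
  (Finsupp.toMultiset (Finsupp.equivFunOnFinite.symm β)).toList

theorem LL_count (β : Fin n → ℕ) (j : Fin n) : (LL β).count j = β j := by
  rw [LL, ← Multiset.coe_count, Multiset.coe_toList, Finsupp.count_toMultiset]
  rfl

theorem LL_length (β : Fin n → ℕ) : (LL β).length = ∑ j, β j := by
  rw [LL, Multiset.length_toList, Finsupp.card_toMultiset, Finsupp.sum_fintype _ _ (by simp)]
  rfl

theorem rel_exists [Nontrivial A] (s l : A) (H : MvPolynomial (Fin n) A)
    (G : Fin n → MvPolynomial (Fin n) A) (d : ℕ) (hH : H.totalDegree ≤ d)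
    (hG : ∀ j, (G j).totalDegree ≤ d) (a : ℕ → ℕ → MvPolynomial (Fin n) A)
    (ha : ∀ N i, i ≤ N → (a N i).totalDegree ≤ (2 * N + 2) * d) :
    ∃ (N : ℕ) (c : Fin (N + 1) × (Fin n → Fin (N + 1)) → A), c ≠ 0 ∧
      ∑ y, C (c y) * (H ^ (n * N - (LL fun j => (y.2 j : ℕ)).length) *
        DL s l H G (N + 1) (LL fun j => (y.2 j : ℕ)) (a N y.1)) = 0 := by
  set e := (n + 2) * d + 1 with he
  set N := e ^ n with hN
  let B := (n + 2) * (N + 1) * d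
  let w : Fin (N + 1) × (Fin n → Fin (N + 1)) → MvPolynomial (Fin n) A := fun y =>
    H ^ (n * N - (LL fun j => (y.2 j : ℕ)).length) *
        DL s l H G (N + 1) (LL fun j => (y.2 j : ℕ)) (a N y.1)
  have hlen : ∀ β : Fin n → Fin (N + 1), (LL fun j => (β j : ℕ)).length ≤ n * N := by
    intro β
    rw [LL_length]
    refine (Finset.sum_le_card_nsmul _ _ N fun j _ => by have := (β j).2; omega).trans ?_
    simp
  have hw : ∀ y, (w y).totalDegree ≤ B := by
    intro y
    refine (totalDegree_mul _ _).trans ?_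
    have h1 := totalDegree_pow H (n * N - (LL fun j => (y.2 j : ℕ)).length)
    have h2 := totalDegree_DL s l H G d hH hG (N + 1) (LL fun j => (y.2 j : ℕ)) (a N y.1)
    have h3 := ha N y.1 (by have := y.1.2; omega)
    have h4 := hlen y.2
    set t := (LL fun j => (y.2 j : ℕ)).length
    have h5 : (n * N - t) * H.totalDegree ≤ (n * N - t) * d := Nat.mul_le_mul_left _ hH
    have h6 : (n * N - t) * d + t * d = n * N * d := by
      rw [← add_mul]; congr 1; omega
    have h7 : n * N * d + (2 * N + 2) * d ≤ B := by
      simp only [B]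
      nlinarith [Nat.zero_le (n * d)]
    omega
  let F : (Fin (N + 1) × (Fin n → Fin (N + 1)) → A) →ₗ[A] ((Fin n → Fin (B + 1)) → A) :=
    { toFun := fun c κ => coeff (Finsupp.equivFunOnFinite.symm fun j => (κ j : ℕ))
        (∑ y, C (c y) * w y)
      map_add' := by
        intro c c'
        ext κ
        simp [add_mul, Finset.sum_add_distrib]
      map_smul' := by
        intro r c
        ext κ
        simp [coeff_sum, Finset.mul_sum, mul_assoc, coeff_C_mul] }
  have hF : ¬ Function.Injective F := by
    intro h
    have := card_le_of_injective A F h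
    simp only [Fintype.card_prod, Fintype.card_fin, Fintype.card_pi_const] at this
    have hB : B + 1 ≤ e * (N + 1) := by
      simp only [B, he]
      nlinarith
    have h2 : (B + 1) ^ n ≤ (e * (N + 1)) ^ n := Nat.pow_le_pow_left hB n
    rw [mul_pow, ← hN] at h2
    have h3 : 0 < (N + 1) ^ n := by positivity
    nlinarith
  rw [← LinearMap.ker_eq_bot, Submodule.eq_bot_iff] at hF
  push Not at hF
  obtain ⟨c, hc, hc0⟩ := hF
  refine ⟨N, c, hc0, ?_⟩
  ext δ
  rw [coeff_zero]
  by_cases hδ : ∀ j, δ j < B + 1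
  · have := congrFun (LinearMap.mem_ker.1 hc) fun j => ⟨δ j, hδ j⟩
    simp only [F, LinearMap.coe_mk, AddHom.coe_mk, Pi.zero_apply] at this
    convert! this using 2
    ext j; simp
  · push Not at hδ
    obtain ⟨j, hj⟩ := hδ
    apply coeff_eq_zero_of_totalDegree_lt
    refine lt_of_le_of_lt (totalDegree_finsetSum_le (d := B) fun y _ => ?_) ?_
    · refine (totalDegree_mul _ _).trans ?_
      rw [totalDegree_C, zero_add]
      exact hw y
    · have h1 : δ j ≤ ∑ i ∈ δ.support, δ i :=
        Finset.single_le_sum (f := fun i => δ i) (fun _ _ => Nat.zero_le _) (by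
          rw [Finsupp.mem_support_iff]; omega)
      omega

theorem rec_exists [Nontrivial A] (s l : A) (H : MvPolynomial (Fin n) A)
    (G : Fin n → MvPolynomial (Fin n) A) (d : ℕ) (hH : H.totalDegree ≤ d)
    (hG : ∀ j, (G j).totalDegree ≤ d) (a : ℕ → ℕ → MvPolynomial (Fin n) A)
    (ha : ∀ N i, i ≤ N → (a N i).totalDegree ≤ (2 * N + 2) * d) :
    ∃ (N : ℕ) (c : Fin (N + 1) → A), c ≠ 0 ∧ ∀ (φ : A →+* ℂ)
      (T : MvPolynomial (Fin n) ℂ →ₗ[ℂ] ℂ),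
      (∀ k < N + 1 + n * N, ∀ j b, T ((map φ H) ^ (N + 1 + n * N - (k + 1)) *
        Dop (φ s) (φ l) (map φ H) (fun j => map φ (G j)) j k b) = 0) →
      ∑ i, φ (c i) * T ((map φ H) ^ (n * N) * map φ (a N i)) = 0 := by
  classical
  obtain ⟨N, c, hc, hrel⟩ := rel_exists s l H G d hH hG a ha
  let S : Finset (Fin n → Fin (N + 1)) := Finset.univ.filter fun β => ∃ i, c (i, β) ≠ 0
  have hS : S.Nonempty := by
    obtain ⟨⟨i, β⟩, h⟩ := Function.ne_iff.1 hc
    exact ⟨β, by simpa [S] using ⟨i, h⟩⟩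
  obtain ⟨α, hα, hmin⟩ := S.exists_min_image (fun β => ∑ j, (β j : ℕ)) hS
  have hα' : ∃ i, c (i, α) ≠ 0 := by simpa [S] using hα
  refine ⟨N, fun i => c (i, α), ?_, ?_⟩
  · obtain ⟨i, hi⟩ := hα'
    exact Function.ne_iff.2 ⟨i, hi⟩
  intro φ T hT
  have hlen : ∀ β : Fin n → Fin (N + 1), (LL fun j => (β j : ℕ)).length ≤ n * N := by
    intro β
    rw [LL_length]
    refine (Finset.sum_le_card_nsmul _ _ N fun j _ => by have := (β j).2; omega).trans ?_
    simp
  let α' : Fin n →₀ ℕ := Finsupp.equivFunOnFinite.symm fun j => (α j : ℕ)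
  have hα'' : ∀ j, α' j = α j := fun j => rfl
  have h1 := congrArg (fun P => T (monomial α' 1 * map φ P)) hrel
  simp only [map_sum, map_mul, map_pow, map_C, map_DL, Finset.mul_sum, map_zero, mul_zero] at h1
  have h2 : ∀ y : Fin (N + 1) × (Fin n → Fin (N + 1)),
      T (monomial α' 1 * (C (φ (c y)) * (map φ H ^ (n * N - (LL fun j => (y.2 j : ℕ)).length) *
        DL (φ s) (φ l) (map φ H) (fun j => map φ (G j)) (N + 1) (LL fun j => (y.2 j : ℕ))
          (map φ (a N y.1))))) = φ (c y) * ((-1) ^ (LL fun j => (y.2 j : ℕ)).length *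
        T (map φ H ^ (n * N) * (pdL (LL fun j => (y.2 j : ℕ)) (monomial α' 1) *
          map φ (a N y.1)))) := by
    intro y
    have h3 := T_DL (φ s) (φ l) (map φ H) (fun j => map φ (G j)) (N + 1 + n * N) T hT (N + 1)
      (LL fun j => (y.2 j : ℕ)) (monomial α' 1) (map φ (a N y.1))
      (by have := hlen y.2; omega)
    rw [Nat.add_sub_cancel_left, Nat.add_sub_add_left] at h3
    rw [← h3]
    generalize DL (φ s) (φ l) (map φ H) (fun j => map φ (G j)) (N + 1) (LL fun j => (y.2 j : ℕ))
      (map φ (a N y.1)) = Z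
    generalize map φ H ^ (n * N - (LL fun j => (y.2 j : ℕ)).length) = Y
    rw [← smul_eq_mul (φ (c y)), ← map_smul, smul_eq_C_mul]
    exact congrArg T (by ring)
  simp only [h2] at h1
  obtain ⟨m, hm, hm'⟩ := pdL_of_eq (A := ℂ) (LL fun j => (α j : ℕ)) α' 1 (by
    intro j; rw [LL_count, hα''])
  have h4 : ∀ β i, β ≠ α → φ (c (i, β)) * ((-1) ^ (LL fun j => (β j : ℕ)).length *
        T (map φ H ^ (n * N) * (pdL (LL fun j => (β j : ℕ)) (monomial α' 1) *
          map φ (a N i)))) = 0 := by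
    intro β i hβ
    by_cases hβS : c (i, β) = 0
    · simp [hβS]
    · have hle := hmin β (by simpa [S] using ⟨i, hβS⟩)
      have : ∃ j, α' j < (LL fun j => (β j : ℕ)).count j := by
        by_contra! hcon
        simp only [LL_count, hα''] at hcon
        apply hβ
        ext j
        by_contra hne
        have : ∑ j, (β j : ℕ) < ∑ j, (α j : ℕ) :=
          Finset.sum_lt_sum (fun j _ => hcon j) ⟨j, Finset.mem_univ _,
            lt_of_le_of_ne (hcon j) hne⟩
        omega
      rw [pdL_of_lt _ _ _ this]
      simp
  rw [Fintype.sum_prod_type] at h1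
  have h5 : ∀ i : Fin (N + 1), (∑ β : Fin n → Fin (N + 1), φ (c (i, β)) *
      ((-1) ^ (LL fun j => (β j : ℕ)).length *
        T (map φ H ^ (n * N) * (pdL (LL fun j => (β j : ℕ)) (monomial α' 1) *
          map φ (a N i))))) = ((-1) ^ (LL fun j => (α j : ℕ)).length * m) *
            (φ (c (i, α)) * T (map φ H ^ (n * N) * map φ (a N i))) := by
    intro i
    rw [Finset.sum_eq_single α (fun β _ h => h4 β i h) (by simp), hm', one_mul]
    have : map φ H ^ (n * N) * (C (m : ℂ) * map φ (a N i)) =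
      (m : ℂ) • (map φ H ^ (n * N) * map φ (a N i)) := by
      rw [smul_eq_C_mul]; ring
    rw [this, map_smul, smul_eq_mul]
    ring
  simp only [h5] at h1
  rw [← Finset.mul_sum] at h1
  refine (mul_eq_zero.1 h1).resolve_left ?_
  exact mul_ne_zero (pow_ne_zero _ (by norm_num)) (Nat.cast_ne_zero.2 hm)

end Alg


section Div
open MvPolynomial Topology

variable {n : ℕ}

def cev (x : Fin n → ℝ) (b : MvPolynomial (Fin n) ℂ) : ℂ := eval (fun i => (x i : ℂ)) b

theorem cev_map (x : Fin n → ℝ) (p : MvPolynomial (Fin n) ℝ) :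
    cev x (map Complex.ofRealHom p) = ((eval x p : ℝ) : ℂ) := by
  unfold cev
  rw [eval_map]
  have := eval₂_comp_left Complex.ofRealHom (RingHom.id ℝ) x p
  simp only [RingHom.comp_id] at this
  rw [← eval₂_id]
  simpa [Function.comp_def] using this.symm

theorem cev_deriv (x : Fin n → ℝ) (j : Fin n) (b : MvPolynomial (Fin n) ℂ) :
    HasDerivAt (fun t : ℝ => cev (x + t • (Pi.single j 1 : Fin n → ℝ)) b)
      (cev x (pderiv j b)) 0 := by
  induction b using MvPolynomial.induction_on with
  | C a => simpa [cev] using hasDerivAt_const (0:ℝ) a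
  | add p q hp hq => simpa [cev] using! hp.add hq
  | mul_X p i hp =>
    have h1 : HasDerivAt (fun t : ℝ => cev (x + t • (Pi.single j 1 : Fin n → ℝ)) (X i))
      (cev x (pderiv j (X i))) 0 := by
      have h2 : HasDerivAt (fun t : ℝ => x i + t * (Pi.single j (1:ℝ) : Fin n → ℝ) i)
        ((Pi.single j (1:ℝ) : Fin n → ℝ) i) 0 := by
        simpa using ((hasDerivAt_id (0:ℝ)).mul_const ((Pi.single j (1:ℝ) : Fin n → ℝ) i)).const_add (x i)
      have h3 := h2.ofReal_comp
      have e : cev x (pderiv j (X i)) = (((Pi.single j (1:ℝ) : Fin n → ℝ) i : ℝ) : ℂ) := by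
        by_cases h : i = j
        · subst h; simp [cev]
        · simp [cev, pderiv_X, Pi.single_apply, h]
      rw [e]
      refine h3.congr_of_eventuallyEq (Filter.Eventually.of_forall fun t => ?_)
      simp [cev]
    have h4 := hp.mul h1
    have e : cev x (pderiv j (p * X i)) = cev x (pderiv j p) * cev (x + (0:ℝ) • (Pi.single j 1 : Fin n → ℝ)) (X i)
        + cev (x + (0:ℝ) • (Pi.single j 1 : Fin n → ℝ)) p * cev x (pderiv j (X i)) := by
      simp only [Derivation.leibniz, smul_eq_mul, zero_smul, add_zero, cev, map_add, map_mul]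
      ring
    rw [e]
    refine h4.congr_of_eventuallyEq (Filter.Eventually.of_forall fun t => ?_)
    simp [cev]

theorem rev_deriv (x : Fin n → ℝ) (j : Fin n) (b : MvPolynomial (Fin n) ℝ) :
    HasDerivAt (fun t : ℝ => eval (x + t • (Pi.single j 1 : Fin n → ℝ)) b)
      (eval x (pderiv j b)) 0 := by
  have h := cev_deriv x j (map Complex.ofRealHom b)
  rw [pderiv_map] at h
  simp only [cev_map] at h
  have := Complex.reCLM.hasFDerivAt.comp_hasDerivAt (0:ℝ) h
  simpa [Function.comp_def] using this

structure Geo (n : ℕ) where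
  p : MvPolynomial (Fin n) ℝ
  q : MvPolynomial (Fin n) ℝ
  w : MvPolynomial (Fin n) ℝ
  U : Set (Fin n → ℝ)
  op : IsOpen U
  bdd : Bornology.IsBounded U
  cl : ∀ x, x ∉ U → eval x (p * q * w) = 0 ∨ ∀ᶠ y in 𝓝 x, y ∉ U
  nz : ∀ x ∈ U, eval x (p * q * w) ≠ 0
  L : ℝ
  hL : ∀ x ∈ U, Real.log (eval x p) - Real.log (eval x q) ≤ L
  M : ℝ
  hM : ∀ x ∈ U, Real.log (eval x (p * q * w)) ≤ M

namespace Geo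
variable (g : Geo n)

def H : MvPolynomial (Fin n) ℝ := g.p * g.q * g.w

def G (j : Fin n) : MvPolynomial (Fin n) ℝ := g.w * (g.q * pderiv j g.p - g.p * pderiv j g.q)

def lf (x : Fin n → ℝ) : ℝ := Real.log (eval x g.p) - Real.log (eval x g.q)
def lh (x : Fin n → ℝ) : ℝ := Real.log (eval x g.H)

def Phi (s l : ℂ) (k : ℕ) (x : Fin n → ℝ) : ℂ :=
  Complex.exp (s * g.lf x + l * g.lh x) / ((eval x g.H : ℝ) : ℂ) ^ k

theorem Phi_bound (s l : ℂ) (k : ℕ) (hs : 0 ≤ s.re) (hl : (k : ℝ) + 2 ≤ l.re) (x : Fin n → ℝ)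
    (hx : x ∈ g.U) : ‖g.Phi s l k x‖ ≤
      Real.exp (s.re * g.L + (l.re - k - 2) * g.M) * (eval x g.H) ^ 2 := by
  have hn : eval x g.H ≠ 0 := g.nz x hx
  have e1 : ∀ m : ℕ, |eval x g.H| ^ m = Real.exp (m * g.lh x) := by
    intro m
    rw [Real.exp_nat_mul, lh, Real.exp_log_eq_abs hn]
  rw [Phi, norm_div, Complex.norm_exp, norm_pow, Complex.norm_real, Real.norm_eq_abs, e1,
    ← Real.exp_sub, ← sq_abs, e1, ← Real.exp_add]
  apply Real.exp_le_exp.2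
  have h1 : g.lf x ≤ g.L := g.hL x hx
  have h2 : g.lh x ≤ g.M := g.hM x hx
  simp only [add_re, mul_re, ofReal_re, ofReal_im, mul_zero, sub_zero]
  push_cast
  nlinarith [mul_le_mul_of_nonneg_left h1 hs, mul_le_mul_of_nonneg_left h2 (by linarith : 0 ≤ l.re - k - 2)]

theorem exists_norm_cev_le (b : MvPolynomial (Fin n) ℂ) : ∃ B, 0 ≤ B ∧ ∀ x ∈ g.U, ‖cev x b‖ ≤ B := by
  have hc : Continuous fun x : Fin n → ℝ => cev x b := by
    unfold cev
    exact (MvPolynomial.continuous_eval b).comp (by fun_prop)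
  obtain ⟨B, hB⟩ := g.bdd.isCompact_closure.exists_bound_of_continuousOn hc.continuousOn
  exact ⟨max B 0, le_max_right _ _, fun x hx => (hB x (subset_closure hx)).trans (le_max_left _ _)⟩

theorem meas_lf : Measurable g.lf := by
  unfold lf
  exact (Real.measurable_log.comp (measurable_eval _)).sub (Real.measurable_log.comp (measurable_eval _))

theorem meas_lh : Measurable g.lh := by
  unfold lh
  exact (Real.measurable_log.comp (measurable_eval _))

theorem meas_cev (b : MvPolynomial (Fin n) ℂ) : Measurable fun x : Fin n → ℝ => cev x b := by
  have hc : Continuous fun x : Fin n → ℝ => cev x b := by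
    unfold cev
    exact (MvPolynomial.continuous_eval b).comp (by fun_prop)
  exact hc.measurable

theorem meas_Phi (s l : ℂ) (k : ℕ) : Measurable (g.Phi s l k) := by
  unfold Phi
  have := g.meas_lf
  have := g.meas_lh
  have := measurable_eval g.H
  fun_prop

theorem vol_U : volume g.U < ⊤ := g.bdd.measure_lt_top

theorem bPhi_bound (s l : ℂ) (k : ℕ) (hs : 0 ≤ s.re) (hl : (k : ℝ) + 2 ≤ l.re)
    (b : MvPolynomial (Fin n) ℂ) : ∃ B, 0 ≤ B ∧ ∀ x ∈ g.U, ‖cev x b * g.Phi s l k x‖ ≤ B * (eval x g.H) ^ 2 := by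
  obtain ⟨B, hB0, hB⟩ := g.exists_norm_cev_le b
  refine ⟨B * Real.exp (s.re * g.L + (l.re - k - 2) * g.M), by positivity, fun x hx => ?_⟩
  rw [norm_mul, mul_assoc]
  exact mul_le_mul (hB x hx) (g.Phi_bound s l k hs hl x hx) (norm_nonneg _) hB0

theorem bPhi_int (s l : ℂ) (k : ℕ) (hs : 0 ≤ s.re) (hl : (k : ℝ) + 2 ≤ l.re)
    (b : MvPolynomial (Fin n) ℂ) : IntegrableOn (fun x => cev x b * g.Phi s l k x) g.U := by
  obtain ⟨B, hB0, hB⟩ := g.bPhi_bound s l k hs hl b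
  obtain ⟨B', hB0', hB'⟩ := g.exists_norm_cev_le (map Complex.ofRealHom (g.H))
  refine Measure.integrableOn_of_bounded (M := B * B' ^ 2) g.vol_U.ne
    ((meas_cev b).mul (g.meas_Phi s l k)).aestronglyMeasurable ?_
  refine (ae_restrict_iff' g.op.measurableSet).2 (Filter.Eventually.of_forall fun x hx => ?_)
  refine (hB x hx).trans (mul_le_mul_of_nonneg_left ?_ hB0)
  have := hB' x hx
  rw [cev_map, Complex.norm_real, Real.norm_eq_abs] at this
  rw [← sq_abs]
  exact pow_le_pow_left₀ (abs_nonneg _) this 2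

theorem lineDeriv (s l : ℂ) (k : ℕ) (hs : 0 ≤ s.re) (hl : (k : ℝ) + 2 ≤ l.re)
    (b : MvPolynomial (Fin n) ℂ) (j : Fin n) (x : Fin n → ℝ) :
    HasLineDerivAt ℝ (g.U.indicator fun x => cev x b * g.Phi s l k x)
      (g.U.indicator (fun x => cev x (Dop s l (map Complex.ofRealHom g.H)
        (fun j => map Complex.ofRealHom (g.G j)) j k b) * g.Phi s l (k + 1) x) x) x
      (Pi.single j 1 : Fin n → ℝ) := by
  unfold HasLineDerivAt
  have hct : Continuous fun t : ℝ => x + t • (Pi.single j 1 : Fin n → ℝ) := by fun_prop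
  have hct0 : Filter.Tendsto (fun t : ℝ => x + t • (Pi.single j 1 : Fin n → ℝ)) (𝓝 0) (𝓝 x) := by
    simpa using hct.tendsto 0
  by_cases hx : x ∈ g.U
  · rw [Set.indicator_of_mem hx]
    have hH : eval x g.H ≠ 0 := g.nz x hx
    have hp : eval x g.p ≠ 0 := fun h => hH (by simp [H, h])
    have hq : eval x g.q ≠ 0 := fun h => hH (by simp [H, h])
    have hw : eval x g.w ≠ 0 := fun h => hH (by simp [H, h])
    have dp := rev_deriv x j g.p
    have dq := rev_deriv x j g.q
    have dH := rev_deriv x j g.H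
    have d1 := ((dp.log (by simpa using hp)).sub (dq.log (by simpa using hq))).ofReal_comp
    have d2 := (dH.log (by simpa using hH)).ofReal_comp
    have d3 := ((d1.const_mul s).add (d2.const_mul l)).cexp
    have d4 := ((dH.ofReal_comp).pow k)
    have hHk : ((eval (x + (0:ℝ) • (Pi.single j 1 : Fin n → ℝ)) g.H : ℝ) : ℂ) ^ k ≠ 0 := by
      simp [hH]
    have d5 := (cev_deriv x j b).mul (d3.div d4 hHk)
    have hev : ∀ᶠ t in 𝓝 (0:ℝ), x + t • (Pi.single j 1 : Fin n → ℝ) ∈ g.U :=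
      hct0.eventually (g.op.mem_nhds hx)
    refine (d5.congr_of_eventuallyEq ?_).congr_deriv ?_
    · filter_upwards [hev] with t ht
      rw [Set.indicator_of_mem ht]
      rfl
    · simp only [zero_smul, add_zero, Pi.sub_apply, Pi.pow_apply, Pi.div_apply, Pi.mul_apply, Pi.add_apply]
      unfold Phi lf lh
      simp only [Dop, cev, map_add, map_mul, eval_C, map_sub]
      have c1 := cev_map x g.H
      have c2 := cev_map x (g.G j)
      have c3 := cev_map x (pderiv j g.H)
      rw [← pderiv_map] at c3
      unfold cev at c1 c2 c3
      rw [c1, c2, c3]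
      simp only [G, map_mul, map_sub]
      have hH2 : eval x g.H = eval x g.p * eval x g.q * eval x g.w := by simp [H]
      generalize eval x (pderiv j g.H) = H'
      rw [hH2]
      generalize eval x g.p = P at *
      generalize eval x g.q = Q at *
      generalize eval x g.w = W at *
      push_cast
      have hP : (P : ℂ) ≠ 0 := by exact_mod_cast hp
      have hQ : (Q : ℂ) ≠ 0 := by exact_mod_cast hq
      have hW : (W : ℂ) ≠ 0 := by exact_mod_cast hw
      rcases k with _ | k
      · simp
        field_simp
        ring
      · simp
        field_simp
        ring
  · rw [Set.indicator_of_notMem hx]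
    rcases g.cl x hx with h0 | h0
    · obtain ⟨B, hB0, hB⟩ := g.bPhi_bound s l k hs hl b
      have dH := (rev_deriv x j g.H).pow 2
      have hx0 : eval x g.H = 0 := h0
      simp only [zero_smul, add_zero, hx0] at dH
      have dH2 := hasDerivAt_iff_isLittleO.1 dH
      rw [hasDerivAt_iff_isLittleO]
      simp only [zero_smul, add_zero, Set.indicator_of_notMem hx, sub_zero, smul_zero] at dH2 ⊢
      refine Asymptotics.IsBigO.trans_isLittleO (g := fun t : ℝ => (eval (x + t • (Pi.single j 1 : Fin n → ℝ)) g.H) ^ 2) ?_ ?_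
      · refine Asymptotics.IsBigO.of_bound B (Filter.Eventually.of_forall fun t => ?_)
        rw [Real.norm_eq_abs, abs_of_nonneg (sq_nonneg _)]
        by_cases ht : x + t • (Pi.single j 1 : Fin n → ℝ) ∈ g.U
        · rw [Set.indicator_of_mem ht]
          exact hB _ ht
        · rw [Set.indicator_of_notMem ht]
          simp; positivity
      · simpa [hx0] using dH2
    · have hev := hct0.eventually h0
      refine (hasDerivAt_const (0:ℝ) (0:ℂ)).congr_of_eventuallyEq ?_
      filter_upwards [hev] with t ht
      rw [Set.indicator_of_notMem ht]

theorem div_zero (s l : ℂ) (k : ℕ) (hs : 0 ≤ s.re) (hl : (k : ℝ) + 3 ≤ l.re)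
    (b : MvPolynomial (Fin n) ℂ) (j : Fin n) :
    ∫ x in g.U, cev x (Dop s l (map Complex.ofRealHom g.H)
        (fun j => map Complex.ofRealHom (g.G j)) j k b) * g.Phi s l (k + 1) x = 0 := by
  have i1 := (integrable_indicator_iff g.op.measurableSet).2 (g.bPhi_int s l k hs (by linarith) b)
  have i2 := (integrable_indicator_iff g.op.measurableSet).2 (g.bPhi_int s l (k+1) hs (by push_cast; linarith)
    (Dop s l (map Complex.ofRealHom g.H) (fun j => map Complex.ofRealHom (g.G j)) j k b))
  have := integral_bilinear_hasLineDerivAt_right_eq_neg_left_of_integrable (μ := volume)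
    (f := fun _ : Fin n → ℝ => (1:ℂ)) (f' := fun _ => 0) (v := (Pi.single j 1 : Fin n → ℝ))
    (g := g.U.indicator fun x => cev x b * g.Phi s l k x)
    (g' := g.U.indicator (fun x => cev x (Dop s l (map Complex.ofRealHom g.H)
        (fun j => map Complex.ofRealHom (g.G j)) j k b) * g.Phi s l (k + 1) x))
    (B := ContinuousLinearMap.mul ℝ ℂ) (by simp) (by simpa using i2) (by simpa using i1)
    (fun x _ => by simp [HasLineDerivAt, hasDerivAt_const]) (fun x _ => g.lineDeriv s l k hs (by linarith) b j x)
  rw [← integral_indicator g.op.measurableSet]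
  simpa using this

end Geo
end Div


section Rec
open MvPolynomial Topology

abbrev KK := algebraicClosure ℚ ℝ

variable {n : ℕ}

theorem totalDegree_map_le {A B : Type*} [CommRing A] [CommRing B] (f : A →+* B) (p : MvPolynomial (Fin n) A) :
    (map f p).totalDegree ≤ p.totalDegree :=
  Finset.sup_mono (support_map_subset f p)

structure Dat (n : ℕ) extends Geo n where
  u : MvPolynomial (Fin n) ℝ
  v : MvPolynomial (Fin n) ℝ
  w' : MvPolynomial (Fin n) ℝ
  hw : w = v * w'
  ap : AlgC p
  aq : AlgC q
  au : AlgC u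
  av : AlgC v
  aw : AlgC w'
  pos : ∀ x ∈ U, 0 < eval x p / eval x q
  B : ℝ
  hB : ∀ x ∈ U, |eval x u / eval x v| ≤ B

namespace Dat
variable (D : Dat n)

def gg (x : Fin n → ℝ) : ℝ := eval x D.u / eval x D.v

def J (s l : ℂ) : ℂ := ∫ x in D.U, (D.gg x : ℂ) * Complex.exp (s * D.lf x + l * D.lh x)

def phi (s l : ℂ) : Polynomial (Polynomial KK) →+* ℂ :=
  Polynomial.eval₂RingHom (Polynomial.eval₂RingHom (algebraMap KK ℂ) s) l

theorem rec1 : ∃ (N : ℕ) (c : Fin (N + 1) → Polynomial (Polynomial KK)) (R : ℝ), c ≠ 0 ∧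
    ∀ s l : ℂ, 0 ≤ s.re → R ≤ l.re → ∑ i : Fin (N+1), phi s l (c i) * D.J (s + (i : ℕ)) l = 0 := by
  obtain ⟨p0, hp0⟩ := AlgC_iff.1 D.ap
  obtain ⟨q0, hq0⟩ := AlgC_iff.1 D.aq
  obtain ⟨u0, hu0⟩ := AlgC_iff.1 D.au
  obtain ⟨v0, hv0⟩ := AlgC_iff.1 D.av
  obtain ⟨w0, hw0⟩ := AlgC_iff.1 D.aw
  set ι : KK →+* Polynomial (Polynomial KK) := Polynomial.C.comp Polynomial.C with hι
  have hφι : ∀ s l, (phi s l).comp ι = Complex.ofRealHom.comp (algebraMap KK ℝ) := by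
    intro s l
    ext x
    simp [phi, hι]
    rfl
  have key : ∀ (s l : ℂ) (r0 : MvPolynomial (Fin n) KK), map (phi s l) (map ι r0) =
      map Complex.ofRealHom (map (algebraMap KK ℝ) r0) := by
    intro s l r0
    rw [map_map, map_map, hφι]
  set H0 := p0 * q0 * (v0 * w0) with hH0
  set G0 : Fin n → MvPolynomial (Fin n) KK :=
    fun j => (v0 * w0) * (q0 * pderiv j p0 - p0 * pderiv j q0) with hG0
  have mH0 : map (algebraMap KK ℝ) H0 = D.H := by
    simp [hH0, Geo.H, D.hw, hp0, hq0, hv0, hw0]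
  have mG0 : ∀ j, map (algebraMap KK ℝ) (G0 j) = D.G j := by
    intro j
    simp [hG0, Geo.G, D.hw, hp0, hq0, hv0, hw0, ← pderiv_map]
  set a0 : ℕ → ℕ → MvPolynomial (Fin n) KK :=
    fun N i => p0 ^ i * u0 * (p0 * v0 * w0) ^ i * (p0 * q0 * w0) * H0 ^ (N - i) with ha0
  set d := p0.totalDegree + u0.totalDegree + (p0 * v0 * w0).totalDegree + (p0 * q0 * w0).totalDegree
    + H0.totalDegree + ∑ j, (G0 j).totalDegree with hd
  have hdeg : ∀ N i, i ≤ N → (map ι (a0 N i)).totalDegree ≤ (2 * N + 2) * d := by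
    intro N i hi
    refine (totalDegree_map_le _ _).trans ?_
    have h1 : (p0 ^ i).totalDegree ≤ i * d := (totalDegree_pow _ _).trans (Nat.mul_le_mul_left _ (by omega))
    have h2 : ((p0 * v0 * w0) ^ i).totalDegree ≤ i * d := (totalDegree_pow _ _).trans (Nat.mul_le_mul_left _ (by omega))
    have h3 : (H0 ^ (N - i)).totalDegree ≤ (N - i) * d := (totalDegree_pow _ _).trans (Nat.mul_le_mul_left _ (by omega))
    have h4 : (a0 N i).totalDegree ≤ i * d + d + i * d + d + (N - i) * d := by
      refine (totalDegree_mul _ _).trans (add_le_add ?_ h3)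
      refine (totalDegree_mul _ _).trans (add_le_add ?_ (by omega))
      refine (totalDegree_mul _ _).trans (add_le_add ?_ h2)
      exact (totalDegree_mul _ _).trans (add_le_add h1 (by omega))
    refine h4.trans ?_
    obtain ⟨e, rfl⟩ := Nat.exists_eq_add_of_le hi
    simp only [Nat.add_sub_cancel_left]
    nlinarith [Nat.zero_le (e * d)]
  obtain ⟨N, c, hc, h⟩ := rec_exists (n := n) (Polynomial.C Polynomial.X : Polynomial (Polynomial KK))
    Polynomial.X (map ι H0) (fun j => map ι (G0 j)) d
    ((totalDegree_map_le _ _).trans (by omega))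
    (fun j => (totalDegree_map_le _ _).trans (by
      have := Finset.single_le_sum (f := fun j => (G0 j).totalDegree) (fun _ _ => Nat.zero_le _) (Finset.mem_univ j)
      omega)) (fun N i => map ι (a0 N i)) hdeg
  refine ⟨N, c, ((N + 1 + n * N : ℕ) : ℝ) + 2, hc, fun s l hs hl => ?_⟩
  set K := N + 1 + n * N with hK
  have hint := fun b => D.bPhi_int s l K hs hl b
  let T : MvPolynomial (Fin n) ℂ →ₗ[ℂ] ℂ :=
    { toFun := fun b => ∫ x in D.U, cev x b * D.Phi s l K x
      map_add' := fun a b => by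
        rw [← integral_add (hint a) (hint b)]
        congr 1; ext x; simp [cev, add_mul]
      map_smul' := fun a b => by
        rw [RingHom.id_apply, smul_eq_mul, ← integral_const_mul]
        congr 1; ext x; simp [cev, mul_assoc, smul_eval] }
  have hTd : ∀ b, T b = ∫ x in D.U, cev x b * D.Phi s l K x := fun b => rfl
  have := h (phi s l) T ?_
  · rw [← this]
    refine Finset.sum_congr rfl fun i _ => ?_
    congr 1
    rw [hTd, J]
    refine setIntegral_congr_fun D.op.measurableSet fun x hx => ?_
    simp only [key, mH0]
    have hH : eval x D.H ≠ 0 := D.nz x hx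
    have eH : eval x D.H = eval x D.p * eval x D.q * (eval x D.v * eval x D.w') := by simp [Geo.H, D.hw]
    have hp : eval x D.p ≠ 0 := fun h => hH (by simp [eH, h])
    have hq : eval x D.q ≠ 0 := fun h => hH (by simp [eH, h])
    have hv : eval x D.v ≠ 0 := fun h => hH (by simp [eH, h])
    have hw : eval x D.w' ≠ 0 := fun h => hH (by simp [eH, h])
    have e1 : Complex.exp ((s + (i:ℕ)) * D.lf x + l * D.lh x) =
      ((eval x D.p / eval x D.q : ℝ) : ℂ) ^ (i:ℕ) * Complex.exp (s * D.lf x + l * D.lh x) := by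
      rw [show (s + (i:ℕ)) * D.lf x + l * D.lh x = ((i:ℕ) : ℂ) * ((D.lf x : ℝ) : ℂ) + (s * D.lf x + l * D.lh x) by ring,
        Complex.exp_add, Complex.exp_nat_mul, ← Complex.ofReal_exp, Geo.lf,
        ← Real.log_div hp hq, Real.exp_log (D.pos x hx)]
    rw [e1]
    have e2 : cev x (map Complex.ofRealHom D.H ^ (n * N) * map Complex.ofRealHom (map (algebraMap KK ℝ) (a0 N i))) =
       ((eval x D.H ^ (n * N) * eval x (map (algebraMap KK ℝ) (a0 N i)) : ℝ) : ℂ) := by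
      rw [← map_pow, ← map_mul, cev_map]; simp
    rw [e2, Geo.Phi, gg]
    obtain ⟨e, he⟩ := Nat.exists_eq_add_of_le (Nat.lt_succ_iff.1 i.2)
    have e3 : N - (i:ℕ) = e := by omega
    simp only [ha0, map_mul, map_pow, mH0, hp0, hq0, hv0, hw0, hu0, e3]
    have e4 : K = n * N + e + i + 1 := by omega
    rw [e4, pow_succ, pow_add, pow_add, eH]
    push_cast
    have hp' : ((eval x D.p : ℝ) : ℂ) ≠ 0 := by exact_mod_cast hp
    have hq' : ((eval x D.q : ℝ) : ℂ) ≠ 0 := by exact_mod_cast hq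
    have hv' : ((eval x D.v : ℝ) : ℂ) ≠ 0 := by exact_mod_cast hv
    have hw' : ((eval x D.w' : ℝ) : ℂ) ≠ 0 := by exact_mod_cast hw
    simp only [div_pow, mul_pow]
    field_simp
  · intro k hk j b
    have h1 := D.div_zero s l k hs (by
      have : ((k + 1 : ℕ) : ℝ) ≤ (K : ℕ) := by exact_mod_cast hk
      push_cast at this ⊢
      linarith) b j
    rw [hTd, ← h1]
    refine setIntegral_congr_fun D.op.measurableSet fun x hx => ?_
    have hH : ((eval x D.H : ℝ) : ℂ) ≠ 0 := by exact_mod_cast D.nz x hx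
    have e5 : phi s l (Polynomial.C Polynomial.X) = s := by simp [phi]
    have e6 : phi s l Polynomial.X = l := by simp [phi]
    simp only [key, mH0, mG0, e5, e6]
    have e2 : ∀ r, cev x (map Complex.ofRealHom D.H ^ (K - (k+1)) * r) =
       ((eval x D.H : ℝ) : ℂ) ^ (K - (k+1)) * cev x r := by
      intro r
      have := cev_map x D.H
      unfold cev at *
      rw [map_mul, map_pow, this]
    rw [e2, Geo.Phi, Geo.Phi]
    obtain ⟨e, he⟩ := Nat.exists_eq_add_of_le (Nat.succ_le_of_lt hk)
    have e3 : K - (k+1) = e := by omega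
    rw [e3, show K = (k+1) + e by omega, pow_add _ (k+1) e]
    field_simp

end Dat
end Rec


section Param
open Topology

variable {X : Type*} [MeasurableSpace X] {μ : Measure X} [IsFiniteMeasure μ]

theorem param_bound {A : X → ℂ} {B : X → ℝ} {a b : ℝ} (hb : 0 ≤ b)
    (hAa : ∀ᵐ x ∂μ, ‖A x‖ ≤ a) (hBb : ∀ᵐ x ∂μ, B x ≤ b) (z : ℂ) (hz : 0 < z.re) (k : ℕ) :
    ∀ᵐ x ∂μ, ‖A x * Complex.exp (z * B x) * (B x : ℂ) ^ k / (k.factorial : ℂ)‖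
      ≤ a * Real.exp (2 * z.re * b) * (z.re⁻¹) ^ k := by
  filter_upwards [hAa, hBb] with x h1 h2
  have ha : 0 ≤ a := (norm_nonneg _).trans h1
  rw [mul_assoc, mul_div_assoc, norm_mul, mul_assoc]
  refine mul_le_mul h1 ?_ (norm_nonneg _) ha
  rw [norm_div, norm_mul, Complex.norm_exp, norm_pow, Complex.norm_real, Real.norm_eq_abs,
    Complex.norm_natCast]
  simp only [mul_re, ofReal_re, ofReal_im, mul_zero, sub_zero]
  have h3 := Real.pow_div_factorial_le_exp (x := z.re * |B x|) (by positivity) k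
  have h4 : Real.exp (z.re * B x) * Real.exp (z.re * |B x|) ≤ Real.exp (2 * z.re * b) := by
    rw [← Real.exp_add]
    apply Real.exp_le_exp.2
    have : B x + |B x| ≤ 2 * b := by
      rcases abs_cases (B x) with h | h <;> linarith
    nlinarith
  rw [inv_pow, ← div_eq_mul_inv, le_div_iff₀ (by positivity)]
  refine le_trans ?_ h4
  calc _ = Real.exp (z.re * B x) * ((z.re * |B x|) ^ k / (k.factorial : ℝ)) := by
        rw [mul_pow]; ring
    _ ≤ _ := mul_le_mul_of_nonneg_left h3 (Real.exp_nonneg _)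

theorem param_int {A : X → ℂ} {B : X → ℝ} {a b : ℝ} (hb : 0 ≤ b) (hA : Measurable A) (hB : Measurable B)
    (hAa : ∀ᵐ x ∂μ, ‖A x‖ ≤ a) (hBb : ∀ᵐ x ∂μ, B x ≤ b) (z : ℂ) (hz : 0 < z.re) (k : ℕ) :
    Integrable (fun x => A x * Complex.exp (z * B x) * (B x : ℂ) ^ k / (k.factorial : ℂ)) μ :=
  Integrable.of_bound (by fun_prop) _ (param_bound hb hAa hBb z hz k)

theorem param_series {A : X → ℂ} {B : X → ℝ} {a b : ℝ} (hb : 0 ≤ b) (hA : Measurable A) (hB : Measurable B)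
    (hAa : ∀ᵐ x ∂μ, ‖A x‖ ≤ a) (hBb : ∀ᵐ x ∂μ, B x ≤ b) (z : ℂ) (hz : 0 < z.re) :
    HasFPowerSeriesAt (fun z => ∫ x, A x * Complex.exp (z * B x) ∂μ)
      (FormalMultilinearSeries.ofScalars ℂ
        fun k => ∫ x, A x * Complex.exp (z * B x) * (B x : ℂ) ^ k / (k.factorial : ℂ) ∂μ) z := by
  rw [hasFPowerSeriesAt_iff]
  filter_upwards [Metric.ball_mem_nhds (0:ℂ) hz] with h hh
  have hh : ‖h‖ < z.re := by simpa using hh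
  simp only [FormalMultilinearSeries.coeff_ofScalars]
  have key := hasSum_integral_of_summable_integral_norm (μ := μ)
    (F := fun k x => h ^ k • (A x * Complex.exp (z * B x) * (B x : ℂ) ^ k / (k.factorial : ℂ)))
    (fun k => (param_int hb hA hB hAa hBb z hz k).const_mul (h ^ k)) ?_
  · simp only [integral_smul] at key
    convert key using 1
    refine integral_congr_ae (Filter.Eventually.of_forall fun x => ?_)
    have h1 := ((NormedSpace.expSeries_div_hasSum_exp (h * B x : ℂ)).mul_left (A x * Complex.exp (z * B x))).tsum_eq
    rw [← Complex.exp_eq_exp_ℂ] at h1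
    simp only
    rw [add_mul, Complex.exp_add, ← mul_assoc, ← h1]
    congr 1; ext k
    rw [smul_eq_mul, mul_pow]; ring
  · refine Summable.of_nonneg_of_le (fun k => integral_nonneg fun x => norm_nonneg _)
      (f := fun k => (a * Real.exp (2 * z.re * b) * (μ.real Set.univ)) * (‖h‖ * z.re⁻¹) ^ k) (fun k => ?_) ?_
    · have h1 : ∀ᵐ x ∂μ, ‖h ^ k • (A x * Complex.exp (z * B x) * (B x : ℂ) ^ k / (k.factorial : ℂ))‖ ≤
          a * Real.exp (2 * z.re * b) * (‖h‖ * z.re⁻¹) ^ k := by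
        filter_upwards [param_bound hb hAa hBb z hz k] with x hx
        rw [norm_smul, norm_pow, mul_pow]
        calc _ ≤ ‖h‖ ^ k * _ := mul_le_mul_of_nonneg_left hx (by positivity)
          _ = _ := by ring
      refine (integral_mono_ae ((param_int hb hA hB hAa hBb z hz k).const_mul (h ^ k)).norm (integrable_const _) h1).trans ?_
      simp only [integral_const, smul_eq_mul]
      apply le_of_eq; ring
    · refine (summable_geometric_of_lt_one (by positivity) ?_).mul_left _
      rw [← div_eq_mul_inv, div_lt_one hz]
      exact hh

end Param

section Rec2
open MvPolynomial Topology
variable {n : ℕ}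
namespace Dat
variable (D : Dat n)

instance : IsFiniteMeasure (volume.restrict D.U) := ⟨by simpa using D.vol_U⟩

theorem meas_gg : Measurable D.gg := (measurable_eval _).div (measurable_eval _)

theorem ae_gg : ∀ᵐ x ∂(volume.restrict D.U), ‖(D.gg x : ℂ)‖ ≤ D.B :=
  (ae_restrict_iff' D.op.measurableSet).2 (Filter.Eventually.of_forall fun x hx => by
    rw [Complex.norm_real, Real.norm_eq_abs]; exact D.hB x hx)

theorem ae_lf : ∀ᵐ x ∂(volume.restrict D.U), D.lf x ≤ max D.L 0 :=
  (ae_restrict_iff' D.op.measurableSet).2 (Filter.Eventually.of_forall fun x hx =>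
    (D.hL x hx).trans (le_max_left _ _))

theorem ae_lh : ∀ᵐ x ∂(volume.restrict D.U), D.lh x ≤ max D.M 0 :=
  (ae_restrict_iff' D.op.measurableSet).2 (Filter.Eventually.of_forall fun x hx =>
    (D.hM x hx).trans (le_max_left _ _))

theorem ae_A (s : ℂ) (hs : 0 ≤ s.re) : ∀ᵐ x ∂(volume.restrict D.U),
    ‖(D.gg x : ℂ) * Complex.exp (s * D.lf x)‖ ≤ D.B * Real.exp (s.re * max D.L 0) := by
  filter_upwards [D.ae_gg, D.ae_lf] with x h1 h2
  rw [norm_mul, Complex.norm_exp]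
  refine mul_le_mul h1 (Real.exp_le_exp.2 ?_) (Real.exp_nonneg _) ((norm_nonneg _).trans h1)
  simpa using mul_le_mul_of_nonneg_left h2 hs

theorem J_analytic (s l : ℂ) (hs : 0 ≤ s.re) (hl : 0 < l.re) : AnalyticAt ℂ (fun l => D.J s l) l := by
  have h1 := D.meas_gg
  have h2 := D.meas_lf
  have h3 := D.meas_lh
  have := (param_series (le_max_right _ _) (A := fun x => (D.gg x : ℂ) * Complex.exp (s * D.lf x))
    (B := D.lh) (by fun_prop) h3 (D.ae_A s hs) D.ae_lh l hl).analyticAt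
  convert this using 2 with l
  unfold J
  congr 1; ext x
  rw [Complex.exp_add]; ring

theorem J_tendsto (s : ℂ) (hs : 0 ≤ s.re) :
    Filter.Tendsto (fun t : ℝ => D.J s (t : ℂ)) (𝓝[>] 0) (𝓝 (D.J s 0)) := by
  have h1 := D.meas_gg
  have h2 := D.meas_lf
  have h3 := D.meas_lh
  unfold J
  refine tendsto_integral_filter_of_dominated_convergence
    (fun _ => D.B * Real.exp (s.re * max D.L 0) * Real.exp (max D.M 0)) ?_ ?_ (integrable_const _) ?_
  · exact Filter.Eventually.of_forall fun t => by fun_prop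
  · have : Set.Ioo (0:ℝ) 1 ∈ 𝓝[>] (0:ℝ) := Ioo_mem_nhdsGT one_pos
    filter_upwards [this] with t ht
    filter_upwards [D.ae_A s hs, D.ae_lh] with x h4 h5
    rw [Complex.exp_add, ← mul_assoc, norm_mul]
    refine mul_le_mul h4 ?_ (norm_nonneg _) ((norm_nonneg _).trans h4)
    rw [Complex.norm_exp]
    apply Real.exp_le_exp.2
    simp only [mul_re, ofReal_re, ofReal_im, mul_zero, sub_zero]
    have : 0 ≤ max D.M 0 := le_max_right _ _
    nlinarith [ht.1, ht.2, mul_le_mul_of_nonneg_left h5 ht.1.le]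
  · refine Filter.Eventually.of_forall fun x => ?_
    have : Continuous fun t : ℝ => (D.gg x : ℂ) * Complex.exp (s * D.lf x + (t:ℂ) * D.lh x) := by fun_prop
    exact (this.tendsto' 0 _ (by simp)).mono_left nhdsWithin_le_nhds

theorem phi_cont (s : ℂ) (c : Polynomial (Polynomial KK)) : AnalyticOnNhd ℂ (fun l => phi s l c) Set.univ := by
  have : (fun l => phi s l c) = fun l => Polynomial.eval l (c.map (Polynomial.eval₂RingHom (algebraMap KK ℂ) s)) := by
    ext l
    simp [phi, Polynomial.eval_map]
  rw [this]
  exact AnalyticOnNhd.eval_polynomial _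

def I0 (s : ℂ) : ℂ := D.J s 0

theorem rec2 : ∃ (N : ℕ) (d : ℕ → Polynomial KK), (∀ i, N < i → d i = 0) ∧ (∃ i, d i ≠ 0) ∧
    ∀ s : ℂ, 0 ≤ s.re → ∑ i ∈ Finset.range (N + 1), Polynomial.aeval s (d i) * D.I0 (s + (i : ℕ)) = 0 := by
  classical
  obtain ⟨N, c, R, hc, h⟩ := D.rec1
  have hex : ∃ m, ∃ i, (c i).coeff m ≠ 0 := by
    obtain ⟨i, hi⟩ := Function.ne_iff.1 hc
    by_contra hcon
    push Not at hcon
    exact hi (Polynomial.ext fun m => by simpa using hcon m i)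
  set m := Nat.find hex with hm
  obtain ⟨i0, hi0⟩ := Nat.find_spec hex
  rw [← hm] at hi0
  have hdvd : ∀ i, Polynomial.X ^ m ∣ c i := by
    intro i
    rw [Polynomial.X_pow_dvd_iff]
    intro d hd
    have := Nat.find_min hex hd
    push Not at this
    exact this i
  choose c' hc' using hdvd
  have hpos : ∀ s l : ℂ, 0 ≤ s.re → 0 < l.re →
      ∑ i : Fin (N+1), phi s l (c' i) * D.J (s + (i : ℕ)) l = 0 := by
    intro s l hs hl
    have hsi : ∀ i : Fin (N+1), 0 ≤ (s + ((i:ℕ):ℂ)).re := fun i => by simp; positivity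
    have han : AnalyticOnNhd ℂ (fun l => ∑ i : Fin (N+1), phi s l (c' i) * D.J (s + (i : ℕ)) l) {l | 0 < l.re} := by
      intro l hl
      refine Finset.analyticAt_fun_sum _ fun i _ => ?_
      exact ((phi_cont s (c' i)) l trivial).mul (D.J_analytic _ l (hsi i) hl)
    refine han.eqOn_zero_of_preconnected_of_eventuallyEq_zero (convex_halfSpace_re_gt 0).isPreconnected
      (z₀ := ((|R| + 1 : ℝ) : ℂ)) ?_ ?_ hl
    · simp; positivity
    · have hopen : IsOpen {l : ℂ | |R| < l.re} := isOpen_lt continuous_const Complex.continuous_re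
      have hmem : ((|R| + 1 : ℝ) : ℂ) ∈ {l : ℂ | |R| < l.re} := by simp
      filter_upwards [hopen.mem_nhds hmem] with l hl
      have hl : |R| < l.re := hl
      have h1 := h s l hs ((le_abs_self R).trans hl.le)
      have h2 : ∀ i, phi s l (c i) = l ^ m * phi s l (c' i) := by
        intro i
        rw [hc' i, map_mul, map_pow]
        simp [phi]
      simp only [h2, mul_assoc, ← Finset.mul_sum] at h1
      have hl0 : l ≠ 0 := by
        rintro rfl
        simp at hl
        exact absurd hl (not_lt.2 (abs_nonneg R))
      simpa [hl0] using h1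
  refine ⟨N, fun i => if h : i < N + 1 then (c' ⟨i, h⟩).coeff 0 else 0, ?_, ⟨i0, ?_⟩, ?_⟩
  · intro i hi
    simp; omega
  · simp only [i0.2, dif_pos]
    rw [hc' i0, Polynomial.coeff_X_pow_mul'] at hi0
    simpa using hi0
  · intro s hs
    have hsi : ∀ i : Fin (N+1), 0 ≤ (s + ((i:ℕ):ℂ)).re := fun i => by simp; positivity
    rw [Finset.sum_range]
    have ht : Filter.Tendsto (fun t : ℝ => ∑ i : Fin (N+1), phi s t (c' i) * D.J (s + (i : ℕ)) t) (𝓝[>] 0)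
        (𝓝 (∑ i : Fin (N+1), phi s 0 (c' i) * D.J (s + (i : ℕ)) 0)) := by
      refine tendsto_finsetSum _ fun i _ => Filter.Tendsto.mul ?_ (D.J_tendsto _ (hsi i))
      have h1 : Continuous fun l => phi s l (c' i) :=
        continuous_iff_continuousAt.2 fun l => (phi_cont s (c' i) l trivial).continuousAt
      have h2 : Continuous fun t : ℝ => phi s (t : ℂ) (c' i) := h1.comp Complex.continuous_ofReal
      exact (h2.tendsto' 0 _ (by simp)).mono_left nhdsWithin_le_nhds
    have h0 : Filter.Tendsto (fun t : ℝ => ∑ i : Fin (N+1), phi s t (c' i) * D.J (s + (i : ℕ)) t) (𝓝[>] 0) (𝓝 0) := by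
      refine tendsto_const_nhds.congr' ?_
      filter_upwards [self_mem_nhdsWithin] with t ht
      exact (hpos s t hs (by simpa using ht)).symm
    have := tendsto_nhds_unique ht h0
    rw [← this]
    refine Finset.sum_congr rfl fun i _ => ?_
    simp only [i.2, dif_pos, I0]
    congr 1
    simp [phi, Polynomial.coeff_zero_eq_eval_zero, Polynomial.aeval_def, Polynomial.eval₂_at_zero]

theorem I0_analytic (s : ℂ) (hs : 0 < s.re) : AnalyticAt ℂ D.I0 s := by
  have h1 := D.meas_gg
  have := (param_series (le_max_right _ _) (A := fun x => (D.gg x : ℂ)) (B := D.lf) (by fun_prop) D.meas_lf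
    D.ae_gg D.ae_lf s hs).analyticAt
  convert this using 2 with s
  simp [I0, J]

theorem aeval_analytic (P : Polynomial KK) (s : ℂ) : AnalyticAt ℂ (fun s => Polynomial.aeval s P) s := by
  have : (fun s => Polynomial.aeval s P) = fun l : ℂ => Polynomial.eval l (P.map (algebraMap KK ℂ)) := by
    ext l
    simp [Polynomial.eval_map, Polynomial.aeval_def]
  rw [this]
  exact AnalyticOnNhd.eval_polynomial _ s trivial

theorem rec3 : ∃ (N : ℕ) (Q : ℕ → Polynomial KK), Q 0 ≠ 0 ∧
    ∀ s : ℂ, 0 < s.re → ∑ i ∈ Finset.range (N + 1), Polynomial.aeval s (Q i) * D.I0 (s + (i : ℕ)) = 0 := by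
  classical
  obtain ⟨N, d, hdN, hex, h⟩ := D.rec2
  set m := Nat.find hex with hm
  have hdm : d m ≠ 0 := Nat.find_spec hex
  have hlt : ∀ i < m, d i = 0 := fun i hi => by simpa using Nat.find_min hex hi
  have htay : ∀ i s, Polynomial.aeval s (Polynomial.taylor (-(m : KK)) (d (m + i))) = Polynomial.aeval (s - (m : ℂ)) (d (m + i)) := by
    intro i s
    rw [Polynomial.taylor_apply, Polynomial.aeval_comp]
    simp [sub_eq_add_neg]
  refine ⟨N, fun i => Polynomial.taylor (-(m : KK)) (d (m + i)), ?_, fun s hs => ?_⟩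
  · simpa [Polynomial.taylor_eq_zero] using hdm
  · have han : AnalyticOnNhd ℂ (fun s => ∑ i ∈ Finset.range (N + 1),
      Polynomial.aeval s (Polynomial.taylor (-(m : KK)) (d (m + i))) * D.I0 (s + (i : ℕ))) {l | 0 < l.re} := by
      intro l hl
      refine Finset.analyticAt_fun_sum _ fun i _ => ?_
      refine (aeval_analytic _ _).mul ?_
      exact (D.I0_analytic (l + i) (by have : 0 < l.re := hl
                                       simp; positivity)).comp_of_eq (analyticAt_id.add analyticAt_const) rfl
    refine han.eqOn_zero_of_preconnected_of_eventuallyEq_zero (convex_halfSpace_re_gt 0).isPreconnected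
      (z₀ := ((m + 1 : ℕ) : ℂ)) ?_ ?_ hs
    · simp; positivity
    · have hopen : IsOpen {l : ℂ | (m : ℝ) < l.re} := isOpen_lt continuous_const Complex.continuous_re
      have hmem : ((m + 1 : ℕ) : ℂ) ∈ {l : ℂ | (m : ℝ) < l.re} := by simp
      filter_upwards [hopen.mem_nhds hmem] with l hl
      have hl : (m : ℝ) < l.re := hl
      have h1 := h (l - m) (by simp; linarith)
      have h2 : ∑ i ∈ Finset.range (m + (N + 1)), Polynomial.aeval (l - m) (d i) * D.I0 (l - m + (i : ℕ)) = 0 := by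
        rw [← h1]
        symm
        refine Finset.sum_subset (Finset.range_mono (by omega)) fun i _ hi => ?_
        rw [hdN i (by simpa using hi)]; simp
      rw [Finset.sum_range_add, Finset.sum_eq_zero (fun i hi => by
        rw [hlt i (by simpa using hi)]; simp), zero_add] at h2
      simp only [Pi.zero_apply]
      rw [← h2]
      refine Finset.sum_congr rfl fun i _ => ?_
      rw [htay]
      congr 2
      push_cast; ring
end Dat
end Rec2


section Ext
open Topology Polynomial

def PerAt (k : ℂ → ℂ) (z : ℂ) : Prop := AnalyticAt ℂ k z ∧ ∀ j, iteratedDeriv j k z ∈ Per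

def MerPer (h : ℂ → ℂ) (z : ℂ) : Prop :=
  ∃ (N : ℕ) (k : ℂ → ℂ), PerAt k z ∧ ∀ᶠ s in 𝓝[≠] z, (s - z) ^ N * h s = k s

theorem Per_mul {c x : ℂ} (hc : c ∈ (algebraMap KK ℂ).range) (hx : x ∈ Per) : c * x ∈ Per := by
  obtain ⟨c, rfl⟩ := hc
  rw [← Algebra.smul_def]
  exact Per.smul_mem c hx

theorem aeval_int_mem (P : KK[X]) (z : ℤ) : aeval (z : ℂ) P ∈ (algebraMap KK ℂ).range := by
  refine ⟨aeval (z : KK) P, ?_⟩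
  rw [← aeval_algebraMap_apply]
  simp

theorem iter_poly (j : ℕ) : ∀ (P : KK[X]) (z : ℤ),
    iteratedDeriv j (fun s : ℂ => aeval s P) z ∈ (algebraMap KK ℂ).range := by
  induction j with
  | zero => intro P z; simpa using aeval_int_mem P z
  | succ j ih =>
    intro P z
    rw [iteratedDeriv_succ']
    have : deriv (fun s : ℂ => aeval s P) = fun s : ℂ => aeval s (derivative P) := by
      ext s
      exact Polynomial.deriv_aeval P
    rw [this]
    exact ih _ z

theorem PerAt.add {k l : ℂ → ℂ} {z : ℂ} (hk : PerAt k z) (hl : PerAt l z) :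
    PerAt (fun s => k s + l s) z := by
  refine ⟨hk.1.add hl.1, fun j => ?_⟩
  rw [iteratedDeriv_fun_add hk.1.contDiffAt hl.1.contDiffAt]
  exact Per.add_mem (hk.2 j) (hl.2 j)

theorem PerAt.mulPoly {k : ℂ → ℂ} {z : ℤ} (hk : PerAt k z) (P : KK[X]) :
    PerAt (fun s => aeval s P * k s) z := by
  refine ⟨(Dat.aeval_analytic P _).mul hk.1, fun j => ?_⟩
  rw [iteratedDeriv_fun_mul (Dat.aeval_analytic P _).contDiffAt hk.1.contDiffAt]
  refine Per.sum_mem fun i _ => Per_mul ?_ (hk.2 _)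
  exact Subring.mul_mem _ (natCast_mem _ _) (iter_poly i P z)

theorem PerAt.divPoly {k : ℂ → ℂ} {z : ℤ} (hk : PerAt k z) (P : KK[X]) (hP : aeval (z : ℂ) P ≠ 0) :
    PerAt (fun s => k s / aeval s P) z := by
  have han : AnalyticAt ℂ (fun s => k s / aeval s P) z := hk.1.div (Dat.aeval_analytic P _) hP
  refine ⟨han, fun j => ?_⟩
  induction j using Nat.strong_induction_on with
  | _ j ih =>
    have hev : (fun s => aeval s P * (k s / aeval s P)) =ᶠ[𝓝 (z : ℂ)] k := by
      filter_upwards [(Dat.aeval_analytic P z).continuousAt.eventually_ne hP] with s hs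
      field_simp
    have h1 := hev.iteratedDeriv_eq j
    rw [iteratedDeriv_fun_mul (Dat.aeval_analytic P _).contDiffAt han.contDiffAt,
      Finset.sum_range_succ'] at h1
    simp only [Nat.choose_zero_right, Nat.cast_one, iteratedDeriv_zero, one_mul, Nat.sub_zero] at h1
    have h2 : aeval (z : ℂ) P * iteratedDeriv j (fun s => k s / aeval s P) z ∈ Per := by
      rw [eq_sub_of_add_eq' h1]
      refine Per.sub_mem (hk.2 j) (Per.sum_mem fun i hi => Per_mul ?_ (ih _ ?_))
      · exact Subring.mul_mem _ (natCast_mem _ _) (iter_poly _ P z)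
      · have := Finset.mem_range.1 hi
        omega
    obtain ⟨c, hc⟩ := aeval_int_mem P z
    have h3 := Per_mul (c := (aeval (z:ℂ) P)⁻¹) ⟨c⁻¹, by rw [map_inv₀, hc]⟩ h2
    rwa [inv_mul_cancel_left₀ hP] at h3

theorem sub_pow_eq (z : ℤ) (N : ℕ) (s : ℂ) : (s - z) ^ N = aeval s ((X - C (z : KK)) ^ N : KK[X]) := by
  simp

theorem MerPer.add {h l : ℂ → ℂ} {z : ℤ} (hh : MerPer h z) (hl : MerPer l z) :
    MerPer (fun s => h s + l s) z := by
  obtain ⟨N, k, hk, e⟩ := hh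
  obtain ⟨N', k', hk', e'⟩ := hl
  refine ⟨N + N', _, (hk.mulPoly ((X - C (z : KK)) ^ N')).add (hk'.mulPoly ((X - C (z : KK)) ^ N)), ?_⟩
  filter_upwards [e, e'] with s h1 h2
  rw [← sub_pow_eq, ← sub_pow_eq, ← h1, ← h2]
  ring

theorem MerPer.zero (z : ℂ) : MerPer (fun _ => 0) z :=
  ⟨0, fun _ => 0, ⟨analyticAt_const, fun j => by
    rw [iteratedDeriv_const]; split_ifs <;> exact Per.zero_mem⟩, by simp⟩

theorem MerPer.sum {ι : Type*} {h : ι → ℂ → ℂ} {z : ℤ} (S : Finset ι) (hh : ∀ i ∈ S, MerPer (h i) z) :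
    MerPer (fun s => ∑ i ∈ S, h i s) z := by
  classical
  induction S using Finset.induction_on with
  | empty => simpa using MerPer.zero z
  | insert a S ha ih =>
    simp only [Finset.sum_insert ha]
    exact (hh a (by simp)).add (ih fun i hi => hh i (by simp [hi]))

theorem MerPer.mulPoly {h : ℂ → ℂ} {z : ℤ} (hh : MerPer h z) (P : KK[X]) :
    MerPer (fun s => aeval s P * h s) z := by
  obtain ⟨N, k, hk, e⟩ := hh
  refine ⟨N, _, hk.mulPoly P, ?_⟩
  filter_upwards [e] with s h1
  rw [← h1]; ring

theorem MerPer.divPoly {h r : ℂ → ℂ} {z : ℤ} (hr : MerPer r z) (P : KK[X]) (hP : P ≠ 0)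
    (he : ∀ᶠ s in 𝓝[≠] (z : ℂ), aeval s P * h s = r s) : MerPer h z := by
  obtain ⟨N, k, hk, e⟩ := hr
  obtain ⟨P', h1, h2⟩ := P.exists_eq_pow_rootMultiplicity_mul_and_not_dvd hP (z : KK)
  set m := P.rootMultiplicity (z : KK)
  have h3 : aeval (z : ℂ) P' ≠ 0 := by
    intro h0
    apply h2
    rw [dvd_iff_isRoot]
    have : aeval (algebraMap KK ℂ (z : KK)) P' = 0 := by simpa using h0
    rw [aeval_algebraMap_apply] at this
    have h5 := (map_eq_zero (algebraMap KK ℂ)).1 this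
    rwa [coe_aeval_eq_eval] at h5
  refine ⟨N + m, _, hk.divPoly P' h3, ?_⟩
  have h4 := (Dat.aeval_analytic P' z).continuousAt.eventually_ne h3
  filter_upwards [e, he, nhdsWithin_le_nhds h4] with s e1 e2 e3
  rw [eq_div_iff e3, ← e1, ← e2]
  rw [h1, map_mul, ← sub_pow_eq]
  ring

theorem MerPer.congr {h r : ℂ → ℂ} {z : ℂ} (hr : MerPer r z)
    (he : ∀ᶠ s in 𝓝[≠] z, h s = r s) : MerPer h z := by
  obtain ⟨N, k, hk, e⟩ := hr
  refine ⟨N, k, hk, ?_⟩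
  filter_upwards [e, he] with s e1 e2
  rw [e2, e1]

theorem tendsto_shift (z c : ℂ) : Filter.Tendsto (fun s => s + c) (𝓝[≠] z) (𝓝[≠] (z + c)) := by
  refine tendsto_nhdsWithin_iff.2 ⟨?_, ?_⟩
  · exact ((continuous_id.add continuous_const).tendsto z).mono_left nhdsWithin_le_nhds
  · filter_upwards [self_mem_nhdsWithin] with s hs
    simpa using hs

theorem MerPer.shift {h : ℂ → ℂ} {z c : ℂ} (hr : MerPer h (z + c)) : MerPer (fun s => h (s + c)) z := by
  obtain ⟨N, k, hk, e⟩ := hr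
  refine ⟨N, fun s => k (s + c), ⟨?_, fun j => ?_⟩, ?_⟩
  · exact hk.1.comp_of_eq (analyticAt_id.add analyticAt_const) rfl
  · rw [iteratedDeriv_comp_add_const]
    exact hk.2 j
  · filter_upwards [(tendsto_shift z c).eventually e] with s hs
    rw [← hs]; ring

theorem MerPer.laurent {h : ℂ → ℂ} {z : ℤ} (hh : MerPer h z) : ∃ (N : ℤ) (a : ℕ → ℂ),
    (∀ i, IsPeriod (a i)) ∧
      ∀ᶠ s in nhdsWithin (z : ℂ) {(z : ℂ)}ᶜ, h s = ∑' i : ℕ, a i * (s - (z : ℂ)) ^ (N + i) := by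
  obtain ⟨N, k, hk, e⟩ := hh
  refine ⟨-(N : ℤ), fun i => iteratedDeriv i k z / (i.factorial : ℂ), fun i => ?_, ?_⟩
  · have := Per_mul (c := ((i.factorial : ℂ))⁻¹) ⟨(i.factorial : KK)⁻¹, by simp⟩ (hk.2 i)
    rw [inv_mul_eq_div] at this
    exact this
  · have h1 := hasFPowerSeriesAt_iff.1 hk.1.hasFPowerSeriesAt
    simp only [FormalMultilinearSeries.coeff_ofScalars] at h1
    have ht : Filter.Tendsto (fun s : ℂ => s - z) (𝓝[≠] (z:ℂ)) (𝓝 0) := by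
      have : Filter.Tendsto (fun s : ℂ => s - z) (𝓝 (z:ℂ)) (𝓝 ((z:ℂ) - z)) :=
        (continuous_id.sub continuous_const).tendsto _
      rw [sub_self] at this
      exact this.mono_left nhdsWithin_le_nhds
    filter_upwards [ht.eventually h1, e, self_mem_nhdsWithin] with s h2 h3 h4
    have h5 : s - z ≠ 0 := sub_ne_zero.2 (by simpa using h4)
    rw [add_sub_cancel] at h2
    have h6 := (h2.mul_left ((s - z) ^ (-(N:ℤ)))).tsum_eq
    rw [← h3, ← mul_assoc, zpow_neg, zpow_natCast, inv_mul_cancel₀ (pow_ne_zero _ h5), one_mul] at h6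
    rw [← h6]
    congr 1; ext i
    rw [zpow_add₀ h5, zpow_neg, zpow_natCast, zpow_natCast, smul_eq_mul]
    ring

def Iext (I0 : ℂ → ℂ) (N : ℕ) (Q : ℕ → KK[X]) (s : ℂ) : ℂ :=
  if 0 < s.re then I0 s else
    -(∑ i : Fin N, aeval s (Q (i + 1)) * Iext I0 N Q (s + ((i : ℕ) + 1 : ℕ))) / aeval s (Q 0)
termination_by ⌈1 - s.re⌉₊
decreasing_by
  rename_i h
  rw [Nat.lt_ceil]
  have hs : s.re ≤ 0 := not_lt.1 h
  simp only [add_re, natCast_re]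
  push_cast
  by_cases h0 : 0 ≤ 1 - (s.re + ((i : ℕ) + 1 : ℝ))
  · have := Nat.ceil_lt_add_one h0
    have : (0:ℝ) ≤ (i : ℕ) := Nat.cast_nonneg _
    linarith
  · rw [Nat.ceil_eq_zero.2 (not_le.1 h0).le]
    simp; linarith

theorem finite_roots (P : KK[X]) (hP : P ≠ 0) (z : ℂ) : ∀ᶠ s in 𝓝[≠] z, aeval s P ≠ 0 := by
  have hfin : (P.rootSet ℂ).Finite := P.rootSet_finite ℂ
  have h2 : (P.rootSet ℂ \ {z})ᶜ ∈ 𝓝 z :=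
    (hfin.subset Set.sdiff_subset).isClosed.isOpen_compl.mem_nhds (by simp)
  filter_upwards [nhdsWithin_le_nhds h2, self_mem_nhdsWithin] with s h3 h4 h5
  exact h3 ⟨mem_rootSet.2 ⟨hP, h5⟩, h4⟩

theorem ext_exists (I0 : ℂ → ℂ) (han : ∀ s : ℂ, 0 < s.re → AnalyticAt ℂ I0 s) (N : ℕ) (Q : ℕ → KK[X])
    (hQ : Q 0 ≠ 0)
    (hrec : ∀ s : ℂ, 0 < s.re → ∑ i ∈ Finset.range (N + 1), aeval s (Q i) * I0 (s + (i : ℕ)) = 0)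
    (hbase : ∀ z : ℤ, 0 < z → ∀ k, iteratedDeriv k I0 z ∈ Per) :
    ∃ I : ℂ → ℂ, MeromorphicOn I Set.univ ∧ (∀ s : ℂ, 0 < s.re → I s = I0 s) ∧
      ∀ z : ℤ, MerPer I z := by
  set I := Iext I0 N Q with hI
  have hpos : ∀ s : ℂ, 0 < s.re → I s = I0 s := by
    intro s hs
    rw [hI, Iext, if_pos hs]
  have hr : ∀ s : ℂ, aeval s (Q 0) ≠ 0 →
      aeval s (Q 0) * I s = -∑ i : Fin N, aeval s (Q (i + 1)) * I (s + ((i : ℕ) + 1 : ℕ)) := by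
    intro s hs
    by_cases h : 0 < s.re
    · have h1 := hrec s h
      rw [Finset.sum_range_succ', Finset.sum_range] at h1
      rw [hpos s h]
      simp only [Nat.cast_zero, add_zero] at h1
      rw [eq_neg_iff_add_eq_zero, ← h1, add_comm]
      congr 1
      refine Finset.sum_congr rfl fun i _ => ?_
      rw [hpos]
      simp; positivity
    · conv_lhs => rw [hI, Iext, if_neg h]
      field_simp
      rfl
  have hnear : ∀ s : ℂ, 0 < s.re → ∀ᶠ t in 𝓝 s, I t = I0 t := by
    intro s hs
    filter_upwards [(isOpen_lt continuous_const Complex.continuous_re).mem_nhds hs] with t ht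
    exact hpos t ht
  have hmer : ∀ k : ℕ, ∀ s : ℂ, -(k : ℝ) < s.re → MeromorphicAt I s := by
    intro k
    induction k with
    | zero =>
      intro s hs
      have hs : 0 < s.re := by simpa using hs
      exact ((han s hs).congr ((hnear s hs).mono fun t h => h.symm)).meromorphicAt
    | succ k ih =>
      intro s hs
      have h1 : MeromorphicAt (fun s => (-∑ i : Fin N, aeval s (Q (i + 1)) * I (s + ((i : ℕ) + 1 : ℕ))) / aeval s (Q 0)) s := by
        refine MeromorphicAt.fun_div (MeromorphicAt.fun_neg (MeromorphicAt.fun_sum fun i _ => ?_))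
          (Dat.aeval_analytic _ _).meromorphicAt
        refine (Dat.aeval_analytic _ _).meromorphicAt.fun_mul ?_
        refine MeromorphicAt.comp_analyticAt (f := I) (g := fun s => s + ((i : ℕ) + 1 : ℕ)) (ih _ ?_) (by fun_prop)
        push_cast at hs
        simp
        have : (0:ℝ) ≤ (i : ℕ) := Nat.cast_nonneg _
        linarith
      refine h1.congr ?_
      filter_upwards [finite_roots (Q 0) hQ s] with t ht
      rw [div_eq_iff ht, ← hr t ht, mul_comm]
  refine ⟨I, fun s _ => ?_, hpos, ?_⟩
  · obtain ⟨k, hk⟩ := exists_nat_gt (-s.re)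
    exact hmer k s (by linarith)
  · have hz : ∀ k : ℕ, ∀ z : ℤ, -(k : ℤ) < z → MerPer I z := by
      intro k
      induction k with
      | zero =>
        intro z hz
        have hz : 0 < z := by simpa using hz
        have hz' : 0 < (z : ℂ).re := by simpa using hz
        refine MerPer.congr (r := I0) ⟨0, I0, ⟨han z hz', hbase z hz⟩, by simp⟩ ?_
        exact nhdsWithin_le_nhds (hnear z hz')
      | succ k ih =>
        intro z hz
        have h1 : MerPer (fun s => ∑ i : Fin N, aeval s (-Q (i + 1)) * I (s + ((i : ℕ) + 1 : ℕ))) z := by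
          refine MerPer.sum _ fun i _ => MerPer.mulPoly ?_ _
          refine MerPer.shift ?_
          have := ih (z + ((i : ℕ) + 1 : ℕ)) (by push_cast at hz ⊢; omega)
          push_cast at this ⊢
          exact this
        refine h1.divPoly (Q 0) hQ ?_
        filter_upwards [finite_roots (Q 0) hQ z] with t ht
        rw [hr t ht]
        simp
    intro z
    exact hz (z.natAbs + 1) z (by have h := neg_abs_le z; push_cast; omega)
end Ext


section Fin
open MvPolynomial Topology
variable {n : ℕ}
namespace Dat
variable (D : Dat n)

theorem AlgC_H : AlgC D.H := by
  unfold Geo.H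
  rw [D.hw]
  exact (D.ap.mul D.aq).mul (D.av.mul D.aw)

theorem base (hU : IsSemiArithmetic D.U) (z : ℤ) (hz : 0 < z) (k : ℕ) : iteratedDeriv k D.I0 z ∈ Per := by
  lift z to ℕ using hz.le with m
  have hm : 0 < m := by exact_mod_cast hz
  have hmre : 0 < (((m : ℤ) : ℂ)).re := by simpa using hm
  have h1 := D.meas_gg
  have hser := param_series (le_max_right _ _) (A := fun x => (D.gg x : ℂ)) (B := D.lf) (by fun_prop) D.meas_lf
    D.ae_gg D.ae_lf ((m : ℤ) : ℂ) hmre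
  have hint := param_int (le_max_right _ _) (A := fun x => (D.gg x : ℂ)) (B := D.lf) (by fun_prop) D.meas_lf
    D.ae_gg D.ae_lf ((m : ℤ) : ℂ) hmre k
  have hI : (fun z : ℂ => ∫ x in D.U, (D.gg x : ℂ) * Complex.exp (z * D.lf x)) = D.I0 := by
    ext s; simp [I0, J]
  rw [hI] at hser
  have heq := (D.I0_analytic _ hmre).hasFPowerSeriesAt.eq_formalMultilinearSeries hser
  have hk := congrArg (fun p => FormalMultilinearSeries.coeff p k) heq
  simp only [FormalMultilinearSeries.coeff_ofScalars] at hk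
  rw [div_eq_iff (by exact_mod_cast Nat.factorial_ne_zero k), mul_comm] at hk
  rw [hk]
  refine Per_mul (natCast_mem _ _) ?_
  set F : (Fin n → ℝ) → ℝ := fun x => eval x (D.p ^ m * D.u) / eval x (D.q ^ m * D.v) *
    Real.log (eval x D.p / eval x D.q) ^ k with hF
  have hpt : ∀ x ∈ D.U, (D.gg x : ℂ) * Complex.exp (((m:ℤ):ℂ) * D.lf x) * (D.lf x : ℂ) ^ k / (k.factorial : ℂ)
      = (k.factorial : ℂ)⁻¹ * ((F x : ℝ) : ℂ) := by
    intro x hx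
    have hH : eval x D.H ≠ 0 := D.nz x hx
    have eH : eval x D.H = eval x D.p * eval x D.q * (eval x D.v * eval x D.w') := by simp [Geo.H, D.hw]
    have hp : eval x D.p ≠ 0 := fun h => hH (by simp [eH, h])
    have hq : eval x D.q ≠ 0 := fun h => hH (by simp [eH, h])
    have e1 : Complex.exp (((m:ℤ):ℂ) * D.lf x) = ((eval x D.p / eval x D.q : ℝ) : ℂ) ^ m := by
      rw [Int.cast_natCast, Complex.exp_nat_mul, ← Complex.ofReal_exp, Geo.lf,
        ← Real.log_div hp hq, Real.exp_log (D.pos x hx)]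
    have e2 : D.lf x = Real.log (eval x D.p / eval x D.q) := by rw [Geo.lf, Real.log_div hp hq]
    rw [e1, e2, hF, gg]
    simp only [map_mul, map_pow]
    push_cast
    rw [div_pow]
    field_simp
  rw [setIntegral_congr_fun D.op.measurableSet hpt, integral_const_mul, integral_complex_ofReal]
  refine Per_mul ⟨(k.factorial : KK)⁻¹, by simp⟩ ?_
  have hFint : IntegrableOn F D.U := by
    have h2 : IntegrableOn (fun x => (k.factorial : ℂ)⁻¹ * ((F x : ℝ) : ℂ)) D.U :=
      IntegrableOn.congr_fun hint hpt D.op.measurableSet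
    have h3 := (Integrable.const_mul h2 (k.factorial : ℂ)).re
    refine Integrable.congr h3 (Filter.Eventually.of_forall fun x => ?_)
    simp only
    rw [mul_inv_cancel_left₀ (by exact_mod_cast Nat.factorial_ne_zero k)]
    simp
  have hper : IsRealPeriod (∫ x in D.U, F x) :=
    log_period k n D.U (D.p ^ m * D.u) (D.q ^ m * D.v) D.p D.q hU ((D.ap.pow m).mul D.au)
      ((D.aq.pow m).mul D.av) D.ap D.aq D.pos hFint
  exact ⟨by simpa using hper, by simpa using IsRealPeriod.zero⟩

end Dat

theorem SAHolds_near {x : Fin n → ℝ} {c : MvPolynomial (Fin n) ℝ × Bool} (h : c.1 = 0 ∨ eval x c.1 ≠ 0) :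
    ∀ᶠ y in 𝓝 x, (SAHolds x c → SAHolds y c) := by
  obtain ⟨c, b⟩ := c
  simp only at h
  rcases h with h | h
  · subst h
    simp [SAHolds]
  · cases b
    · by_cases h0 : 0 < eval x c
      · have := (MvPolynomial.continuous_eval c).continuousAt.eventually (lt_mem_nhds h0)
        filter_upwards [this] with y hy
        simp [SAHolds, hy]
      · simp [SAHolds, h0]
    · simp [SAHolds, h]

theorem mk_dat (p q u v : MvPolynomial (Fin n) ℝ)
    (hp : AlgC p) (hq : AlgC q) (hu : AlgC u) (hv : AlgC v)
    (C : Set (Fin n → ℝ)) (hCsa : IsSemiArithmetic C) (hCcomp : IsCompact C)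
    (hqne : ∀ x ∈ C, eval x q ≠ 0)
    (hvne : ∀ x ∈ C, eval x v ≠ 0)
    (hfnonneg : ∀ x ∈ C, 0 ≤ eval x p / eval x q) (hfnz : ∃ x ∈ C, eval x p / eval x q ≠ 0) :
    ∃ D : Dat n, D.p = p ∧ D.q = q ∧ D.u = u ∧ D.v = v ∧ IsSemiArithmetic D.U ∧ D.U ⊆ C ∧
      volume (C \ D.U) = 0 := by
  classical
  obtain ⟨L, hL, hC⟩ := (isSA_iff C).1 hCsa
  set nzp : MvPolynomial (Fin n) ℝ → MvPolynomial (Fin n) ℝ := fun c => if c = 0 then 1 else c with hnzp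
  set W : MvPolynomial (Fin n) ℝ := (L.map fun l => (l.map fun c => nzp c.1).prod).prod with hW
  have hnz : ∀ c, nzp c ≠ 0 := by
    intro c
    simp only [hnzp]
    split_ifs with h
    · exact one_ne_zero
    · exact h
  have hW0 : W ≠ 0 := by
    apply List.prod_ne_zero
    intro h
    obtain ⟨l, _, h1⟩ := List.mem_map.1 h
    rw [List.prod_eq_zero_iff] at h1
    obtain ⟨c, _, h2⟩ := List.mem_map.1 h1
    exact hnz _ h2
  have hone : AlgC (1 : MvPolynomial (Fin n) ℝ) := by simpa using! AlgC.nat (m := n) 1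
  have hprod : ∀ l : List (MvPolynomial (Fin n) ℝ), (∀ a ∈ l, AlgC a) → AlgC l.prod := by
    intro l
    induction l with
    | nil => intro _; simpa using hone
    | cons a l ih =>
      intro h
      rw [List.prod_cons]
      exact (h a (by simp)).mul (ih fun b hb => h b (by simp [hb]))
  have hWa : AlgC W := by
    apply hprod
    intro a ha
    obtain ⟨l, hl, rfl⟩ := List.mem_map.1 ha
    apply hprod
    intro a ha
    obtain ⟨c, hc, rfl⟩ := List.mem_map.1 ha
    simp only [hnzp]
    split_ifs
    · exact hone
    · exact hL l hl c hc
  have hWd : ∀ l ∈ L, ∀ c ∈ l, ∀ x, eval x W ≠ 0 → c.1 = 0 ∨ eval x c.1 ≠ 0 := by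
    intro l hl c hc x hx
    by_cases h0 : c.1 = 0
    · exact Or.inl h0
    · right
      intro h
      apply hx
      have : c.1 ∣ W := by
        have h1 : nzp c.1 ∣ (l.map fun c => nzp c.1).prod := List.dvd_prod (List.mem_map.2 ⟨c, hc, rfl⟩)
        have h2 : (l.map fun c => nzp c.1).prod ∣ W := List.dvd_prod (List.mem_map.2 ⟨l, hl, rfl⟩)
        have h3 : nzp c.1 = c.1 := by simp [hnzp, h0]
        rw [h3] at h1
        exact h1.trans h2
      obtain ⟨r, hr⟩ := this
      rw [hr, map_mul, h, zero_mul]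
  set H := p * q * (v * W) with hH
  have hHfac : ∀ x, eval x H ≠ 0 → eval x p ≠ 0 ∧ eval x q ≠ 0 ∧ eval x v ≠ 0 ∧ eval x W ≠ 0 := by
    intro x hx
    refine ⟨fun h => hx ?_, fun h => hx ?_, fun h => hx ?_, fun h => hx ?_⟩ <;> simp [hH, h]
  have hHa : AlgC H := (hp.mul hq).mul (hv.mul hWa)
  have hH0 : H ≠ 0 := by
    obtain ⟨x, hx, hx0⟩ := hfnz
    have hp0 : p ≠ 0 := by rintro rfl; simp at hx0
    have hq0 : q ≠ 0 := by rintro rfl; simp at hx0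
    have hv0 : v ≠ 0 := by
      rintro rfl
      exact hvne x hx (by simp)
    exact mul_ne_zero (mul_ne_zero hp0 hq0) (mul_ne_zero hv0 hW0)
  set U := C ∩ {x | eval x H ≠ 0} with hU
  have hopen : IsOpen U := by
    rw [isOpen_iff_mem_nhds]
    rintro x ⟨hxC, hxH⟩
    have hxH : eval x H ≠ 0 := hxH
    refine Filter.inter_mem ?_ ((MvPolynomial.continuous_eval H).continuousAt.eventually_ne hxH)
    have hxC' := hxC
    rw [hC] at hxC'
    obtain ⟨l, hl, h⟩ := hxC'
    have hev : ∀ᶠ y in 𝓝 x, ∀ c ∈ l.toFinset, (SAHolds x c → SAHolds y c) := by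
      rw [Filter.eventually_all_finset]
      intro c hc
      exact SAHolds_near (hWd l hl c (List.mem_toFinset.1 hc) x (hHfac x hxH).2.2.2)
    filter_upwards [hev] with y hy
    rw [hC]
    exact ⟨l, hl, fun c hc => hy c (List.mem_toFinset.2 hc) (h c hc)⟩
  have hbd : ∀ a b : MvPolynomial (Fin n) ℝ, (∀ x ∈ C, eval x b ≠ 0) → ∃ M, ∀ x ∈ C, |eval x a / eval x b| ≤ M := by
    intro a b hb
    obtain ⟨M, hM⟩ := hCcomp.exists_bound_of_continuousOn (f := fun x => eval x a / eval x b)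
      ((MvPolynomial.continuous_eval a).continuousOn.div (MvPolynomial.continuous_eval b).continuousOn hb)
    exact ⟨M, fun x hx => by simpa only [Real.norm_eq_abs] using hM x hx⟩
  obtain ⟨M1, hM1⟩ := hbd p q hqne
  obtain ⟨M2, hM2⟩ := hbd u v hvne
  obtain ⟨M3, hM3⟩ := hbd H 1 (by simp)
  have hpos : ∀ x ∈ U, 0 < eval x p / eval x q := by
    intro x hx
    obtain ⟨a, b, _, _⟩ := hHfac x hx.2
    exact lt_of_le_of_ne (hfnonneg x hx.1) (div_ne_zero a b).symm
  refine ⟨{ p := p, q := q, w := v * W, U := U, op := hopen, bdd := hCcomp.isBounded.subset Set.inter_subset_left,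
            cl := ?_, nz := fun x hx => hx.2, L := M1, hL := ?_, M := M3, hM := ?_, u := u, v := v, w' := W,
            hw := rfl, ap := hp, aq := hq, au := hu, av := hv, aw := hWa, pos := hpos, B := M2,
            hB := fun x hx => hM2 x hx.1 }, rfl, rfl, rfl, rfl, ?_, Set.inter_subset_left, ?_⟩
  · intro x hx
    by_cases hxC : x ∈ C
    · left
      by_contra h
      exact hx ⟨hxC, h⟩
    · right
      filter_upwards [hCcomp.isClosed.isOpen_compl.mem_nhds hxC] with y hy hyU
      exact hy hyU.1
  · intro x hx
    obtain ⟨a, b, _, _⟩ := hHfac x hx.2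
    rw [← Real.log_div a b]
    have := Real.log_le_sub_one_of_pos (hpos x hx)
    have := (le_abs_self _).trans (hM1 x hx.1)
    linarith
  · intro x hx
    rw [← Real.log_abs]
    have h1 := Real.log_le_self (abs_nonneg (eval x H))
    have h2 := hM3 x hx.1
    simp only [map_one, div_one] at h2
    exact h1.trans h2
  · have : U = C ∩ ({x | 0 < eval x H} ∪ {x | 0 < eval x (-H)}) := by
      rw [hU]
      congr 1
      ext x
      simp only [Set.mem_ofPred_eq, Set.mem_union, map_neg, Left.neg_pos_iff]
      constructor
      · intro h; exact (lt_or_gt_of_ne h).symm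
      · rintro (h | h)
        · exact h.ne'
        · exact h.ne
    change IsSemiArithmetic U
    rw [this]
    exact SA_inter hCsa (SA_union (SA_pos hHa) (SA_pos hHa.neg))
  · refine measure_mono_null ?_ (null_zero n H hH0)
    rintro x ⟨h1, h2⟩
    by_contra h
    exact h2 ⟨h1, h⟩

end Fin

/-- For rational functions `f = p/q` and `g = u/v` with real algebraic coefficients whose
denominators do not vanish on a compact semi-arithmetic set `C`, with `f` non-negative and
not identically zero on `C`, all coefficients of the Laurent expansion of the meromorphic
continuation of `I(s) = ∫_C f^s g dμ` at any integer `s₀` are periods. -/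
theorem igusa_zeta_general_laurent_coefficients_are_periods
    (n : ℕ) (p q u v : MvPolynomial (Fin n) ℝ)
    (hp : ∀ d, IsAlgebraic ℚ (p.coeff d)) (hq : ∀ d, IsAlgebraic ℚ (q.coeff d))
    (hu : ∀ d, IsAlgebraic ℚ (u.coeff d)) (hv : ∀ d, IsAlgebraic ℚ (v.coeff d))
    (C : Set (Fin n → ℝ)) (hCsa : IsSemiArithmetic C) (hCcomp : IsCompact C)
    (hqne : ∀ x ∈ C, MvPolynomial.eval x q ≠ 0)
    (hvne : ∀ x ∈ C, MvPolynomial.eval x v ≠ 0)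
    (f g : (Fin n → ℝ) → ℝ)
    (hf : f = fun x => MvPolynomial.eval x p / MvPolynomial.eval x q)
    (hg : g = fun x => MvPolynomial.eval x u / MvPolynomial.eval x v)
    (hfnonneg : ∀ x ∈ C, 0 ≤ f x) (hfnz : ∃ x ∈ C, f x ≠ 0) :
    ∃ I : ℂ → ℂ,
      MeromorphicOn I Set.univ ∧
      (∀ s : ℂ, 0 < s.re →
        IntegrableOn (fun x => if f x = 0 then 0 else ((f x : ℂ) ^ s * (g x : ℂ))) C volume ∧
        I s = ∫ x in C, if f x = 0 then (0 : ℂ) else (f x : ℂ) ^ s * (g x : ℂ)) ∧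
      (∀ s₀ : ℤ, ∃ (N : ℤ) (a : ℕ → ℂ),
        (∀ i, IsPeriod (a i)) ∧
        ∀ᶠ s in nhdsWithin (s₀ : ℂ) {(s₀ : ℂ)}ᶜ,
          I s = ∑' i : ℕ, a i * (s - (s₀ : ℂ)) ^ (N + i)) := by
  subst hf hg
  obtain ⟨D, rfl, rfl, rfl, rfl, hUsa, hUC, hvol⟩ :=
    mk_dat p q u v hp hq hu hv C hCsa hCcomp hqne hvne hfnonneg hfnz
  have hae : (D.U : Set (Fin n → ℝ)) =ᵐ[volume] C := by
    refine ae_eq_set.2 ⟨?_, hvol⟩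
    rw [Set.sdiff_eq_empty.2 hUC, measure_empty]
  have hpt : ∀ s : ℂ, ∀ x ∈ D.U, (if MvPolynomial.eval x D.p / MvPolynomial.eval x D.q = 0 then (0 : ℂ)
      else ((MvPolynomial.eval x D.p / MvPolynomial.eval x D.q : ℝ) : ℂ) ^ s *
        ((MvPolynomial.eval x D.u / MvPolynomial.eval x D.v : ℝ) : ℂ)) =
      (D.gg x : ℂ) * Complex.exp (s * D.lf x) := by
    intro s x hx
    have h0 := D.pos x hx
    have hp0 : MvPolynomial.eval x D.p ≠ 0 := fun h => by simp [h] at h0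
    have hq0 : MvPolynomial.eval x D.q ≠ 0 := fun h => by simp [h] at h0
    rw [if_neg h0.ne', Complex.cpow_def_of_ne_zero (by exact_mod_cast h0.ne'),
      ← Complex.ofReal_log h0.le, Real.log_div hp0 hq0, mul_comm, mul_comm _ s]
    rfl
  have h1 := D.meas_gg
  obtain ⟨N, Q, hQ, hrec⟩ := D.rec3
  obtain ⟨I, hI1, hI2, hI3⟩ := ext_exists D.I0 D.I0_analytic N Q hQ hrec (D.base hUsa)
  refine ⟨I, hI1, fun s hs => ⟨?_, ?_⟩, fun z => (hI3 z).laurent⟩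
  · have hint := param_int (le_max_right _ _) (A := fun x => (D.gg x : ℂ)) (B := D.lf) (by fun_prop) D.meas_lf
      D.ae_gg D.ae_lf s hs 0
    simp only [pow_zero, mul_one, Nat.factorial_zero, Nat.cast_one, div_one] at hint
    have h2 := IntegrableOn.congr_fun hint (fun x hx => (hpt s x hx).symm) D.op.measurableSet
    exact h2.congr_set_ae hae.symm
  · rw [hI2 s hs, ← setIntegral_congr_set hae, setIntegral_congr_fun D.op.measurableSet (hpt s)]
    simp [Dat.I0, Dat.J]
end
end

section
/- Let h be holomorphic on the half-plane {s ∈ ℂ : Re(s) > 0} and suppose there exist constants A and R ≥ 1 with |h(s)| ≤ A · R^{Re(s)} for all s with Re(s) > 0. Let c_0, …, c_m be polynomials with complex coefficients such that Σ_{i=0}^m c_i(n) h(n+i) = 0 for every sufficiently large positive integer n. Then Σ_{i=0}^m c_i(s) h(s+i) = 0 for every complex s with Re(s) > 0. -/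
open Complex

lemma blaschke_step (C : ℝ) (G : ℂ → ℂ) (hG : DiffContOnCl ℂ G {z : ℂ | 0 < z.re})
    (hC : ∀ s : ℂ, 0 ≤ s.re → ‖G s‖ ≤ C) (a : ℝ) (ha : 0 < a) (hz : G a = 0) :
    ∃ G' : ℂ → ℂ, DiffContOnCl ℂ G' {z : ℂ | 0 < z.re} ∧
      (∀ s : ℂ, 0 ≤ s.re → ‖G' s‖ ≤ C) ∧ ∀ s : ℂ, (s - a) * G' s = (s + a) * G s := by
  have hopen : IsOpen {z : ℂ | 0 < z.re} := isOpen_lt continuous_const continuous_re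
  have hmem : {z : ℂ | 0 < z.re} ∈ nhds (a : ℂ) := hopen.mem_nhds (by simpa using ha)
  have hC0 : 0 ≤ C := (norm_nonneg _).trans (hC 0 (by simp))
  have hid : ∀ s : ℂ, (s - a) * ((s + a) * dslope G a s) = (s + a) * G s := by
    intro s
    have := sub_smul_dslope G a s
    rw [hz, smul_eq_mul, sub_zero] at this
    rw [← this]; ring
  have hDC : DiffContOnCl ℂ (fun s => (s + a) * dslope G a s) {z : ℂ | 0 < z.re} := by
    have h1 : DiffContOnCl ℂ (fun s : ℂ => s + a) {z : ℂ | 0 < z.re} :=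
      (differentiable_id.add_const _).diffContOnCl
    refine h1.smul (⟨(differentiableOn_dslope hmem).2 hG.1, ?_⟩)
    refine (continuousOn_dslope ?_).2 ⟨hG.2, hG.differentiableAt hopen (by simpa using ha)⟩
    exact Filter.mem_of_superset hmem subset_closure
  have hfar : ∀ s : ℂ, 0 ≤ s.re → 3 * a ≤ ‖s‖ → ‖(s + a) * dslope G a s‖ ≤ 2 * C := by
    intro s hs hn
    have h1 : ‖s - a‖ * ‖(s + a) * dslope G a s‖ = ‖s + a‖ * ‖G s‖ := by
      rw [← norm_mul, hid s, norm_mul]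
    have hna : ‖(a : ℂ)‖ = a := by simp [abs_of_pos ha]
    have h2 : ‖s‖ - a ≤ ‖s - a‖ := by
      have := norm_sub_norm_le s (a : ℂ)
      rwa [hna] at this
    have h3 : ‖s + a‖ ≤ ‖s‖ + a := by
      have := norm_add_le s (a : ℂ)
      rwa [hna] at this
    have h4 : ‖s + a‖ ≤ 2 * ‖s - a‖ := by linarith
    have h5 : 0 < ‖s - a‖ := by linarith
    have h6 := hC s hs
    have h7 : ‖s + a‖ * ‖G s‖ ≤ 2 * ‖s - a‖ * C := by gcongr
    by_contra! hlt
    have := mul_lt_mul_of_pos_left hlt h5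
    linarith
  refine ⟨fun s => (s + a) * dslope G a s, hDC, ?_, hid⟩
  intro s hs
  refine PhragmenLindelof.right_half_plane_of_bounded_on_real
    (f := fun s => (s + a) * dslope G a s) hDC ?_ ?_ ?_ hs
  · refine ⟨1, by norm_num, 0, ?_⟩
    refine Asymptotics.IsBigO.of_bound (2 * C) ?_
    rw [Filter.eventually_inf_principal]
    filter_upwards [eventually_cobounded_le_norm (3 * a)] with z hz hz'
    simpa using hfar z (le_of_lt hz') hz
  · refine Filter.isBoundedUnder_of_eventually_le (a := 2 * C) ?_
    filter_upwards [Filter.eventually_ge_atTop (3 * a)] with x hx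
    have hx0 : 0 ≤ x := by linarith
    refine hfar x (by simpa using hx0) ?_
    simpa [abs_of_nonneg hx0] using hx
  · intro x
    have h1 : ‖(x * I - a : ℂ)‖ * ‖(x * I + a) * dslope G a (x * I)‖
        = ‖(x * I + a : ℂ)‖ * ‖G (x * I)‖ := by
      rw [← norm_mul, hid, norm_mul]
    have h2 : ‖(x * I - a : ℂ)‖ = ‖(x * I + a : ℂ)‖ := by
      rw [Complex.norm_def, Complex.norm_def]; congr 1; simp [normSq_apply]
    have h3 : ‖(x * I + a : ℂ)‖ ≠ 0 := by
      intro h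
      have := congrArg re (norm_eq_zero.1 h)
      simp at this; linarith
    rw [h2] at h1
    rw [mul_left_cancel₀ h3 h1]
    exact hC _ (by simp)

lemma blaschke_iter (C : ℝ) (G : ℂ → ℂ) (hG : DiffContOnCl ℂ G {z : ℂ | 0 < z.re})
    (hC : ∀ s : ℂ, 0 ≤ s.re → ‖G s‖ ≤ C) (hz : ∀ n : ℕ, 0 < n → G n = 0) (M : ℕ) :
    ∃ G' : ℂ → ℂ, DiffContOnCl ℂ G' {z : ℂ | 0 < z.re} ∧
      (∀ s : ℂ, 0 ≤ s.re → ‖G' s‖ ≤ C) ∧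
      (∀ n : ℕ, M < n → G' n = 0) ∧
      ∀ s : ℂ, (∏ j ∈ Finset.range M, (s - (j + 1 : ℕ))) * G' s
        = (∏ j ∈ Finset.range M, (s + (j + 1 : ℕ))) * G s := by
  induction M with
  | zero => exact ⟨G, hG, hC, hz, by simp⟩
  | succ M ih =>
    obtain ⟨G₁, h1, h2, h3, h4⟩ := ih
    obtain ⟨G₂, k1, k2, k3⟩ := blaschke_step C G₁ h1 h2 ((M + 1 : ℕ) : ℝ) (by positivity)
      (by simpa using h3 (M + 1) (by omega))
    refine ⟨G₂, k1, k2, ?_, ?_⟩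
    · intro n hn
      have := k3 n
      rw [h3 n (by omega), mul_zero] at this
      refine (mul_eq_zero.1 this).resolve_left ?_
      rw [← ne_eq, sub_ne_zero]
      norm_cast
      omega
    · intro s
      have e := k3 s
      rw [ofReal_natCast] at e
      rw [Finset.prod_range_succ, Finset.prod_range_succ, mul_assoc, e]
      linear_combination (s + (M + 1 : ℕ)) * h4 s

lemma blaschke_zero (C : ℝ) (G : ℂ → ℂ) (hG : DiffContOnCl ℂ G {z : ℂ | 0 < z.re})
    (hC : ∀ s : ℂ, 0 ≤ s.re → ‖G s‖ ≤ C) (hz : ∀ n : ℕ, 0 < n → G n = 0)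
    (x : ℝ) (hx0 : 0 < x) (hx1 : x < 1) : G x = 0 := by
  have hC0 : 0 ≤ C := (norm_nonneg _).trans (hC 0 (by simp))
  have key : ∀ M : ℕ, ‖G x‖ ≤
      C * Real.exp (-(2 * x * ∑ j ∈ Finset.range M, 1 / ((j : ℝ) + 1 ) / 2)) := by
    intro M
    obtain ⟨G', -, h2, -, h4⟩ := blaschke_iter C G hG hC hz M
    have e := congrArg norm (h4 x)
    rw [norm_mul, norm_mul, norm_prod, norm_prod] at e
    have hpos : 0 < ∏ j ∈ Finset.range M, ‖(x : ℂ) + (j + 1 : ℕ)‖ := by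
      refine Finset.prod_pos fun j _ => ?_
      rw [norm_pos_iff]
      norm_cast
      positivity
    have hle : ∏ j ∈ Finset.range M, ‖(x : ℂ) - (j + 1 : ℕ)‖ ≤
        Real.exp (-(2 * x * ∑ j ∈ Finset.range M, 1 / ((j : ℝ) + 1 ) / 2)) *
        ∏ j ∈ Finset.range M, ‖(x : ℂ) + (j + 1 : ℕ)‖ := by
      rw [Finset.mul_sum, ← Finset.sum_neg_distrib, Real.exp_sum, ← Finset.prod_mul_distrib]
      refine Finset.prod_le_prod (fun _ _ => norm_nonneg _) fun j _ => ?_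
      have hj : (0 : ℝ) ≤ j := Nat.cast_nonneg j
      have n1 : ‖(x : ℂ) - (j + 1 : ℕ)‖ = (j + 1) - x := by
        rw [← ofReal_natCast, ← ofReal_sub, norm_real, Real.norm_eq_abs, abs_of_nonpos]
        · push_cast; ring
        · push_cast; linarith
      have n2 : ‖(x : ℂ) + (j + 1 : ℕ)‖ = (j + 1) + x := by
        rw [← ofReal_natCast, ← ofReal_add, norm_real, Real.norm_eq_abs, abs_of_nonneg]
        · push_cast; ring
        · positivity
      rw [n1, n2]
      have h5 := Real.add_one_le_exp (-(2 * x * (1 / ((j : ℝ) + 1) / 2)))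
      have h6 : ((j : ℝ) + 1) - x ≤ (-(2 * x * (1 / ((j : ℝ) + 1) / 2)) + 1) * (j + 1 + x) := by
        have : x / ((j : ℝ) + 1) ≤ 1 := by
          rw [div_le_one (by positivity)]; linarith
        have e1 : (-(2 * x * (1 / ((j : ℝ) + 1) / 2)) + 1) * (j + 1 + x)
            = j + 1 - x * (x / (j + 1)) := by field_simp; ring
        rw [e1]
        nlinarith
      exact h6.trans (mul_le_mul_of_nonneg_right h5 (by positivity))
    have hb := h2 x (by simpa using hx0.le)
    refine le_of_mul_le_mul_left ?_ hpos
    rw [← e]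
    calc _ ≤ (Real.exp (-(2 * x * ∑ j ∈ Finset.range M, 1 / ((j : ℝ) + 1 ) / 2)) *
        ∏ j ∈ Finset.range M, ‖(x : ℂ) + (j + 1 : ℕ)‖) * C := by gcongr
      _ = _ := by ring
  have hlim : Filter.Tendsto (fun M : ℕ =>
      C * Real.exp (-(2 * x * ∑ j ∈ Finset.range M, 1 / ((j : ℝ) + 1 ) / 2)))
      Filter.atTop (nhds 0) := by
    have h1 := Real.tendsto_sum_range_one_div_nat_succ_atTop
    have h2 := (Real.tendsto_exp_neg_atTop_nhds_zero.comp (h1.const_mul_atTop hx0)).const_mul C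
    rw [mul_zero] at h2
    refine h2.congr fun M => ?_
    simp only [Function.comp]
    rw [← Finset.sum_div]
    congr 3
    ring
  have := ge_of_tendsto' hlim key
  exact norm_le_zero_iff.1 this

lemma poly_bound (p : Polynomial ℂ) (d : ℕ) (hd : p.natDegree ≤ d) :
    ∃ K : ℝ, 0 ≤ K ∧ ∀ w : ℂ, 1 ≤ ‖w‖ → ‖p.eval w‖ ≤ K * ‖w‖ ^ d := by
  refine ⟨∑ i ∈ Finset.range (p.natDegree + 1), ‖p.coeff i‖, by positivity, fun w hw => ?_⟩
  rw [Polynomial.eval_eq_sum_range, Finset.sum_mul]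
  refine (norm_sum_le _ _).trans (Finset.sum_le_sum fun i hi => ?_)
  rw [norm_mul, norm_pow]
  have : i ≤ d := by have := Finset.mem_range.1 hi; omega
  gcongr

/-- A recurrence among the values of a holomorphic function `h` of controlled exponential
growth on the right half-plane, valid at all sufficiently large positive integers, extends
to a functional equation on the whole half-plane (via Carleson's theorem). -/
theorem recurrence_extends_to_half_plane
    (h : ℂ → ℂ) (hd : DifferentiableOn ℂ h {s : ℂ | 0 < s.re})
    (A R : ℝ) (hR : 1 ≤ R)
    (hb : ∀ s : ℂ, 0 < s.re → ‖h s‖ ≤ A * R ^ s.re)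
    (m : ℕ) (c : Fin (m + 1) → Polynomial ℂ)
    (hrec : ∃ n₀ : ℕ, ∀ n : ℕ, n₀ ≤ n →
      ∑ i : Fin (m + 1), (c i).eval (n : ℂ) * h ((n : ℂ) + (i : ℕ)) = 0) :
    ∀ s : ℂ, 0 < s.re →
      ∑ i : Fin (m + 1), (c i).eval s * h (s + (i : ℕ)) = 0 := by
  obtain ⟨n₀, hrec⟩ := hrec
  have hR0 : 0 < R := by linarith
  have hopen : IsOpen {z : ℂ | 0 < z.re} := isOpen_lt continuous_const continuous_re
  set F : ℂ → ℂ := fun s => ∑ i : Fin (m + 1), (c i).eval s * h (s + (i : ℕ)) with hF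
  have hFd : DifferentiableOn ℂ F {z : ℂ | 0 < z.re} := by
    refine DifferentiableOn.fun_sum fun i _ => ?_
    refine (c i).differentiable.differentiableOn.mul ?_
    refine hd.comp (by fun_prop) ?_
    intro z hz
    have hz' : 0 < z.re := hz
    have : (0 : ℝ) ≤ ((i : ℕ) : ℝ) := Nat.cast_nonneg _
    simp only [Set.mem_ofPred_eq, add_re, natCast_re]
    linarith
  set N : ℕ := n₀ + 1 with hN
  set d : ℕ := ∑ i, ((c i).comp (Polynomial.X + Polynomial.C (n₀ : ℂ))).natDegree with hdd
  set G : ℂ → ℂ := fun s => F (s + N) * ((R : ℂ) ^ (-s) / (s + 1) ^ d) with hGdef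
  have hs1 : ∀ s : ℂ, 0 ≤ s.re → 1 ≤ ‖s + 1‖ := by
    intro s hs
    refine le_trans ?_ (re_le_norm _)
    simp; exact hs
  have hGd : DiffContOnCl ℂ G {z : ℂ | 0 < z.re} := by
    refine DifferentiableOn.diffContOnCl ?_
    rw [closure_setOfPred_lt_re]
    refine DifferentiableOn.mul ?_ (DifferentiableOn.div ?_ ?_ ?_)
    · refine hFd.comp (by fun_prop) ?_
      intro z hz
      have hz' : 0 ≤ z.re := hz
      have : (0 : ℝ) < (N : ℝ) := by positivity
      simp only [Set.mem_ofPred_eq, add_re, natCast_re]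
      linarith
    · intro z _
      refine DifferentiableAt.differentiableWithinAt ?_
      exact (differentiableAt_id.neg).const_cpow (Or.inl (by exact_mod_cast hR0.ne'))
    · fun_prop
    · intro z hz
      refine pow_ne_zero _ ?_
      rw [← norm_pos_iff]
      linarith [hs1 z hz]
  have hGz : ∀ n : ℕ, 0 < n → G n = 0 := by
    intro n _
    have := hrec (n + N) (by omega)
    push_cast at this
    simp only [hGdef, hF]
    rw [this, zero_mul]
  have hterm : ∀ i : Fin (m + 1), ∃ K : ℝ, ∀ s : ℂ, 0 ≤ s.re →
      ‖(c i).eval (s + N) * h (s + N + (i : ℕ)) * ((R : ℂ) ^ (-s) / (s + 1) ^ d)‖ ≤ K := by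
    intro i
    obtain ⟨K, hK0, hK⟩ := poly_bound ((c i).comp (Polynomial.X + Polynomial.C (n₀ : ℂ))) d
      (Finset.single_le_sum (f := fun i => ((c i).comp
        (Polynomial.X + Polynomial.C (n₀ : ℂ))).natDegree) (fun _ _ => Nat.zero_le _)
        (Finset.mem_univ i))
    refine ⟨K * (A * R ^ ((N : ℝ) + (i : ℕ))), fun s hs => ?_⟩
    have h1 := hs1 s hs
    have h2 := hK _ h1
    have e2 : ((c i).comp (Polynomial.X + Polynomial.C (n₀ : ℂ))).eval (s + 1)
        = (c i).eval (s + N) := by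
      simp only [Polynomial.eval_comp, Polynomial.eval_add, Polynomial.eval_X, Polynomial.eval_C]
      congr 1; rw [hN]; push_cast; ring
    rw [e2] at h2
    have hre : (s + N + (i : ℕ)).re = s.re + ((N : ℝ) + (i : ℕ)) := by
      simp only [add_re, natCast_re]; ring
    have h3 := hb (s + N + (i : ℕ)) (by rw [hre, hN]; push_cast; positivity)
    rw [hre, Real.rpow_add hR0] at h3
    rw [norm_mul, norm_mul, norm_div, norm_pow, norm_cpow_eq_rpow_re_of_pos hR0, neg_re,
      Real.rpow_neg hR0.le]
    have hp : 0 < R ^ s.re := Real.rpow_pos_of_pos hR0 _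
    have hq : 0 < ‖s + 1‖ ^ d := by positivity
    calc _ ≤ (K * ‖s + 1‖ ^ d) * (A * (R ^ s.re * R ^ ((N : ℝ) + (i : ℕ)))) *
          ((R ^ s.re)⁻¹ / ‖s + 1‖ ^ d) := by gcongr
      _ = _ := by field_simp
  choose K hK using hterm
  have hGb : ∀ s : ℂ, 0 ≤ s.re → ‖G s‖ ≤ ∑ i, K i := by
    intro s hs
    simp only [hGdef, hF]
    rw [Finset.sum_mul]
    exact (norm_sum_le _ _).trans (Finset.sum_le_sum fun i _ => hK i s hs)
  have hzero := blaschke_zero _ G hGd hGb hGz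
  have hFz : ∀ x : ℝ, 0 < x → x < 1 → F (x + N) = 0 := by
    intro x hx0 hx1
    refine (mul_eq_zero.1 (hzero x hx0 hx1)).resolve_right ?_
    refine div_ne_zero ?_ (pow_ne_zero _ ?_)
    · rw [← norm_pos_iff, norm_cpow_eq_rpow_re_of_pos hR0]
      exact Real.rpow_pos_of_pos hR0 _
    · rw [← norm_pos_iff]
      linarith [hs1 x (by simpa using hx0.le)]
  have hFa : AnalyticOnNhd ℂ F {z : ℂ | 0 < z.re} := hFd.analyticOnNhd hopen
  have hpre : IsPreconnected {z : ℂ | 0 < z.re} :=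
    (convex_halfSpace_re_gt 0).isPreconnected
  set z₀ : ℂ := ((1 / 2 : ℝ) : ℂ) + N with hz₀
  have hz₀m : z₀ ∈ {z : ℂ | 0 < z.re} := by
    simp only [hz₀, Set.mem_ofPred_eq, add_re, natCast_re, ofReal_re]
    positivity
  have hfreq : ∃ᶠ z in nhdsWithin z₀ {z₀}ᶜ, F z = 0 := by
    have ht : Filter.Tendsto (fun x : ℝ => (x : ℂ) + N) (nhdsWithin (1 / 2) {1 / 2}ᶜ)
        (nhdsWithin z₀ {z₀}ᶜ) := by
      refine tendsto_nhdsWithin_of_tendsto_nhds_of_eventually_within _ ?_ ?_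
      · refine Filter.Tendsto.mono_left ?_ nhdsWithin_le_nhds
        exact Continuous.tendsto' (by fun_prop) _ _ rfl
      · filter_upwards [self_mem_nhdsWithin] with x hx
        simp only [hz₀, Set.mem_compl_iff, Set.mem_singleton_iff, add_left_inj, ofReal_inj]
        exact hx
    refine ht.frequently (Filter.Eventually.frequently ?_)
    have : Set.Ioo (0 : ℝ) 1 ∈ nhds (1 / 2 : ℝ) := Ioo_mem_nhds (by norm_num) (by norm_num)
    filter_upwards [nhdsWithin_le_nhds this] with x hx
    exact hFz x hx.1 hx.2
  intro s hs
  exact hFa.eqOn_zero_of_preconnected_of_frequently_eq_zero hpre hz₀m hfreq hs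
end
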